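/- arXiv:1311.7692 — 4 statements merged into one kernel-verified Lean document; each statement's English description precedes it below -/
import Mathlib

section
/- Let η̃, τ̃ be complex with 0 < Im η̃ < Im τ̃, and let X, Y be parameters with θ₂(Y; η̃) ≠ 0. Define K_X^{(Y)}(z) = (i/2π)(θ₁'(0)/θ₁(X))[e^{2πiY} θ₁(z+X+η̃)/θ₁(z+η̃) - e^{-2πiY} θ₁(z+X-η̃)/θ₁(z-η̃)] (theta functions of period τ̃). Then its Fourier coefficients on [-1/2,1/2] are K_m = e^{2πiY} e^{2πimη̃}/(1-e^{2πi(X+mτ̃)}) + e^{-2πiY} e^{-2πimη̃}/(1-e^{-2πi(X+mτ̃)}), assuming e^{2πi(X+mτ̃)} ≠ 1 for all m ∈ ℤ. -/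
open Complex Real BigOperators

/-- The Jacobi theta function `θ₁(z;τ)`. -/
noncomputable def jacobiTheta₁ (z τ : ℂ) : ℂ :=
  -Complex.I * ∑' k : ℤ, (-1 : ℂ) ^ k *
    Complex.exp ((π : ℂ) * Complex.I * τ * ((k : ℂ) + 1 / 2) ^ 2) *
    Complex.exp (2 * (π : ℂ) * Complex.I * ((k : ℂ) + 1 / 2) * z)

/-- The derivative of `θ₁` with respect to `z`. -/
noncomputable def jacobiTheta₁' (z τ : ℂ) : ℂ :=
  deriv (fun w => jacobiTheta₁ w τ) z

/-- The Jacobi theta function `θ₂(z;τ) = θ₁(z+1/2;τ)`. -/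
noncomputable def jTheta₂ (z τ : ℂ) : ℂ :=
  jacobiTheta₁ (z + 1 / 2) τ

/-- The deformed kernel `K_X^{(Y)}(z)`, built from theta functions of quasi-period `τt`. -/
noncomputable def kernelK (X Y ηt τt z : ℂ) : ℂ :=
  Complex.I / (2 * (π : ℂ)) * (jacobiTheta₁' 0 τt / jacobiTheta₁ X τt) *
    (Complex.exp (2 * (π : ℂ) * Complex.I * Y) *
        jacobiTheta₁ (z + X + ηt) τt / jacobiTheta₁ (z + ηt) τt -
      Complex.exp (-2 * (π : ℂ) * Complex.I * Y) *
        jacobiTheta₁ (z + X - ηt) τt / jacobiTheta₁ (z - ηt) τt)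

section

open Filter Topology

/-- The character `z ↦ exp (2πiz)`. -/
noncomputable def expTwoPiI (z : ℂ) : ℂ :=
  Complex.exp (2 * (π : ℂ) * Complex.I * z)

lemma expTwoPiI_zero : expTwoPiI 0 = 1 := by simp [expTwoPiI]

lemma expTwoPiI_add (z w : ℂ) : expTwoPiI (z + w) = expTwoPiI z * expTwoPiI w := by
  rw [expTwoPiI, mul_add, Complex.exp_add]; rfl

lemma expTwoPiI_neg (z : ℂ) : expTwoPiI (-z) = (expTwoPiI z)⁻¹ := by
  rw [expTwoPiI, mul_neg, Complex.exp_neg]; rfl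

lemma expTwoPiI_ne_zero (z : ℂ) : expTwoPiI z ≠ 0 := Complex.exp_ne_zero _

lemma expTwoPiI_int_mul (k : ℤ) (z : ℂ) : expTwoPiI (k * z) = expTwoPiI z ^ k := by
  rw [expTwoPiI, expTwoPiI, ← Complex.exp_int_mul]; congr 1; ring

lemma norm_expTwoPiI (z : ℂ) : ‖expTwoPiI z‖ = Real.exp (-2 * π * z.im) := by
  rw [expTwoPiI, Complex.norm_exp]
  congr 1
  simp

lemma norm_expTwoPiI_ofReal (t : ℝ) : ‖expTwoPiI t‖ = 1 := by simp [norm_expTwoPiI]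

lemma norm_expTwoPiI_lt_one {τ : ℂ} (hτ : 0 < τ.im) : ‖expTwoPiI τ‖ < 1 := by
  rw [norm_expTwoPiI, Real.exp_lt_one_iff]
  have := mul_pos Real.pi_pos hτ
  linarith

lemma continuous_expTwoPiI : Continuous expTwoPiI := by
  unfold expTwoPiI; fun_prop

lemma hasDerivAt_expTwoPiI (z : ℂ) :
    HasDerivAt expTwoPiI (2 * π * Complex.I * expTwoPiI z) z := by
  have h := ((hasDerivAt_id z).const_mul (2 * (π : ℂ) * Complex.I)).cexp
  rw [show expTwoPiI = fun z => Complex.exp (2 * π * Complex.I * z) from rfl]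
  simpa [mul_comm] using h

lemma expTwoPiI_int_mul_ofReal_integral (k : ℤ) :
    ∫ t in (-(1 / 2) : ℝ)..(1 / 2 : ℝ), expTwoPiI (k * (t : ℂ)) = if k = 0 then 1 else 0 := by
  split_ifs with hk
  · simp only [hk, Int.cast_zero, zero_mul, expTwoPiI_zero, intervalIntegral.integral_const]
    norm_num
  · have hc : 2 * (π : ℂ) * Complex.I * k ≠ 0 := by
      simp [Real.pi_ne_zero, hk]
    have h := integral_exp_mul_complex (a := -(1 / 2)) (b := 1 / 2) hc
    simp only [expTwoPiI, ← mul_assoc]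
    rw [h, div_eq_zero_iff, sub_eq_zero, Complex.exp_eq_exp_iff_exists_int]
    left
    exact ⟨k, by push_cast; ring⟩

/-- Termwise integration of an absolutely convergent Fourier series. -/
lemma integral_tsum_mul_expTwoPiI {b : ℤ → ℂ} (hb : Summable fun k => ‖b k‖) (m : ℤ) :
    ∫ t in (-(1 / 2) : ℝ)..(1 / 2 : ℝ),
      (∑' k : ℤ, b k * expTwoPiI (k * (t : ℂ))) * expTwoPiI (-(m * (t : ℂ))) = b m := by
  have hterm : ∀ (k : ℤ) (t : ℝ), b k * expTwoPiI (k * (t : ℂ)) * expTwoPiI (-(m * (t : ℂ))) =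
      b k * expTwoPiI ((k - m : ℤ) * (t : ℂ)) := by
    intro k t
    rw [mul_assoc, ← expTwoPiI_add]
    congr 2
    push_cast
    ring
  have hcont : ∀ k : ℤ, Continuous fun t : ℝ => b k * expTwoPiI ((k - m : ℤ) * (t : ℂ)) := by
    intro k
    have := continuous_expTwoPiI
    fun_prop
  have hs := intervalIntegral.hasSum_integral_of_dominated_convergence
    (F := fun (k : ℤ) (t : ℝ) => b k * expTwoPiI ((k - m : ℤ) * (t : ℂ)))
    (f := fun t : ℝ => ∑' k : ℤ, b k * expTwoPiI ((k - m : ℤ) * (t : ℂ)))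
    (a := -(1 / 2)) (b := 1 / 2) (μ := MeasureTheory.volume)
    (fun k _ => ‖b k‖) (fun k => (hcont k).aestronglyMeasurable)
    (fun k => Eventually.of_forall fun t _ => by
      rw [norm_mul, ← Complex.ofReal_intCast, ← Complex.ofReal_mul, norm_expTwoPiI_ofReal, mul_one])
    (Eventually.of_forall fun t _ => hb) (by simp)
    (Eventually.of_forall fun t _ => by
      refine (Summable.of_norm ?_).hasSum
      refine hb.congr fun k => ?_
      rw [norm_mul, ← Complex.ofReal_intCast, ← Complex.ofReal_mul, norm_expTwoPiI_ofReal,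
        mul_one])
  have hint : ∀ t : ℝ, (∑' k : ℤ, b k * expTwoPiI (k * (t : ℂ))) * expTwoPiI (-(m * (t : ℂ))) =
      ∑' k : ℤ, b k * expTwoPiI ((k - m : ℤ) * (t : ℂ)) := by
    intro t
    rw [← tsum_mul_right]
    exact tsum_congr fun k => hterm k t
  simp only [hint]
  rw [← hs.tsum_eq, tsum_eq_single m]
  · rw [intervalIntegral.integral_const_mul, expTwoPiI_int_mul_ofReal_integral]
    simp
  · intro k hk
    rw [intervalIntegral.integral_const_mul, expTwoPiI_int_mul_ofReal_integral,
      if_neg (sub_ne_zero.2 hk), mul_zero]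

/-- The Fourier coefficients of `θ₁`, stripped of the factor `exp (πiz)`. -/
noncomputable def thetaCoeff (τ : ℂ) (k : ℤ) : ℂ :=
  (-1 : ℂ) ^ k * Complex.exp ((π : ℂ) * Complex.I * τ * ((k : ℂ) + 1 / 2) ^ 2)

/-- The `1`-periodic function `i exp (-πiz) θ₁(z;τ)`. -/
noncomputable def thetaSeries (τ z : ℂ) : ℂ :=
  ∑' k : ℤ, thetaCoeff τ k * expTwoPiI (k * z)

lemma jacobiTheta₁_eq_thetaSeries (z τ : ℂ) :
    jacobiTheta₁ z τ = -Complex.I * expTwoPiI (z / 2) * thetaSeries τ z := by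
  rw [jacobiTheta₁, thetaSeries, mul_assoc (-Complex.I)]
  congr 1
  rw [← tsum_mul_left]
  refine tsum_congr fun k => ?_
  rw [thetaCoeff, mul_left_comm, ← expTwoPiI_add, expTwoPiI]
  congr 2
  ring

lemma thetaCoeff_ne_zero (τ : ℂ) (k : ℤ) : thetaCoeff τ k ≠ 0 :=
  mul_ne_zero (zpow_ne_zero _ (by norm_num)) (Complex.exp_ne_zero _)

lemma thetaCoeff_add_one (τ : ℂ) (k : ℤ) :
    thetaCoeff τ (k + 1) = -expTwoPiI τ ^ (k + 1) * thetaCoeff τ k := by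
  rw [thetaCoeff, thetaCoeff, ← expTwoPiI_int_mul, expTwoPiI, zpow_add_one₀ (by norm_num)]
  have : (π : ℂ) * Complex.I * τ * (((k + 1 : ℤ) : ℂ) + 1 / 2) ^ 2 =
      2 * π * Complex.I * (((k + 1 : ℤ) : ℂ) * τ) +
        (π : ℂ) * Complex.I * τ * ((k : ℂ) + 1 / 2) ^ 2 := by
    push_cast; ring
  rw [this, Complex.exp_add]
  ring

lemma thetaCoeff_neg_sub_one (τ : ℂ) (k : ℤ) : thetaCoeff τ (-1 - k) = -thetaCoeff τ k := by
  rw [thetaCoeff, thetaCoeff, zpow_sub₀ (by norm_num), div_eq_mul_inv, ← inv_zpow]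
  have h : ((-1 - k : ℤ) : ℂ) + 1 / 2 = -((k : ℂ) + 1 / 2) := by push_cast; ring
  rw [h, neg_sq, show (-1 : ℂ)⁻¹ = -1 by norm_num, zpow_neg_one]
  ring

lemma thetaCoeff_mul_expTwoPiI (τ z : ℂ) (k : ℤ) :
    thetaCoeff τ k * expTwoPiI (k * z) =
      Complex.exp (π * Complex.I * τ / 4) * jacobiTheta₂_term k (z + (1 + τ) / 2) τ := by
  have h : (-1 : ℂ) ^ k = Complex.exp (k * (π * Complex.I)) := by
    rw [Complex.exp_int_mul, Complex.exp_pi_mul_I]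
  rw [thetaCoeff, h, expTwoPiI, jacobiTheta₂_term, ← Complex.exp_add, ← Complex.exp_add,
    ← Complex.exp_add]
  congr 1
  ring

lemma thetaSeries_eq_jacobiTheta₂ (τ z : ℂ) :
    thetaSeries τ z = Complex.exp (π * Complex.I * τ / 4) * jacobiTheta₂ (z + (1 + τ) / 2) τ := by
  rw [thetaSeries, jacobiTheta₂, ← tsum_mul_left]
  exact tsum_congr fun k => thetaCoeff_mul_expTwoPiI τ z k

lemma summable_norm_thetaCoeff_mul {τ : ℂ} (hτ : 0 < τ.im) (z : ℂ) :
    Summable fun k : ℤ => ‖thetaCoeff τ k * expTwoPiI (k * z)‖ := by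
  simp only [thetaCoeff_mul_expTwoPiI]
  exact (((summable_jacobiTheta₂_term_iff _ _).2 hτ).mul_left _).norm

lemma summable_norm_thetaCoeff {τ : ℂ} (hτ : 0 < τ.im) : Summable fun k : ℤ => ‖thetaCoeff τ k‖ := by
  simpa [expTwoPiI_zero] using summable_norm_thetaCoeff_mul hτ 0

lemma differentiable_thetaSeries {τ : ℂ} (hτ : 0 < τ.im) : Differentiable ℂ (thetaSeries τ) := by
  have : thetaSeries τ = fun z =>
      Complex.exp (π * Complex.I * τ / 4) * jacobiTheta₂ (z + (1 + τ) / 2) τ :=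
    funext (thetaSeries_eq_jacobiTheta₂ τ)
  rw [this]
  intro z
  have h := (differentiableAt_jacobiTheta₂_fst (z + (1 + τ) / 2) hτ).comp z
    (differentiableAt_id.add_const ((1 + τ) / 2))
  exact h.const_mul _

lemma tsum_thetaCoeff (τ : ℂ) : ∑' k : ℤ, thetaCoeff τ k = 0 := by
  have h := (Equiv.subLeft (-1 : ℤ)).tsum_eq (thetaCoeff τ)
  simp only [Equiv.subLeft_apply, thetaCoeff_neg_sub_one, tsum_neg] at h
  linear_combination -(1 / 2 : ℂ) * h

lemma thetaSeries_zero (τ : ℂ) : thetaSeries τ 0 = 0 := by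
  simpa [thetaSeries, expTwoPiI_zero] using tsum_thetaCoeff τ

lemma thetaSeries_eq_add_period (τ z : ℂ) :
    thetaSeries τ z = -expTwoPiI τ * expTwoPiI z * thetaSeries τ (z + τ) := by
  rw [thetaSeries, ← (Equiv.addRight (1 : ℤ)).tsum_eq, thetaSeries, ← tsum_mul_left]
  refine tsum_congr fun k => ?_
  have h1 : (((k + 1 : ℤ) : ℂ)) * z = z + k * z := by push_cast; ring
  simp only [Equiv.coe_addRight]
  rw [h1, thetaCoeff_add_one, mul_add, expTwoPiI_add, expTwoPiI_add,
    zpow_add_one₀ (expTwoPiI_ne_zero τ), ← expTwoPiI_int_mul]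
  ring

lemma exists_thetaSeries_ofReal_ne_zero {τ : ℂ} (hτ : 0 < τ.im) :
    ∃ t : ℝ, thetaSeries τ t ≠ 0 := by
  by_contra! h
  have := integral_tsum_mul_expTwoPiI (summable_norm_thetaCoeff hτ) 0
  change ∫ t in (-(1 / 2) : ℝ)..(1 / 2 : ℝ), thetaSeries τ t * _ = _ at this
  simp only [h] at this
  exact thetaCoeff_ne_zero τ 0 (by simpa using this.symm)

/-- The Laurent coefficients of the Kronecker series. -/
noncomputable def kroneckerCoeff (x q : ℂ) (m : ℤ) : ℂ := (1 - x * q ^ m)⁻¹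

/-- The Kronecker series `∑ uᵐ / (1 - x qᵐ)`. -/
noncomputable def kroneckerSeries (x q u : ℂ) : ℂ := ∑' m : ℤ, kroneckerCoeff x q m * u ^ m

lemma exists_norm_inv_one_sub_mul_pow_le (x : ℂ) {q : ℂ} (hq : ‖q‖ < 1) :
    ∃ B : ℝ, 0 ≤ B ∧ ∀ n : ℕ, ‖(1 - x * q ^ n)⁻¹‖ ≤ B := by
  have h : Tendsto (fun n : ℕ => (1 - x * q ^ n)⁻¹) atTop (𝓝 (1 - x * 0)⁻¹) :=
    (((tendsto_pow_atTop_nhds_zero_of_norm_lt_one hq).const_mul x).const_sub 1).inv₀ (by simp)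
  obtain ⟨B, hB⟩ := (Metric.isBounded_range_of_tendsto _ h).exists_norm_le
  exact ⟨B, (norm_nonneg _).trans (hB _ ⟨0, rfl⟩), fun n => hB _ ⟨n, rfl⟩⟩

/-- Removing the geometric series `∑_{m ≥ 0} uᵐ` from the Kronecker series leaves coefficients
decaying like `|q| ^ |m|`. -/
lemma exists_norm_kroneckerCoeff_sub_le {x q : ℂ} (hx : x ≠ 0) (hq0 : q ≠ 0) (hq : ‖q‖ < 1)
    (hxq : ∀ m : ℤ, x * q ^ m ≠ 1) :
    ∃ C : ℝ, 0 ≤ C ∧ ∀ m : ℤ,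
      ‖kroneckerCoeff x q m - if 0 ≤ m then 1 else 0‖ ≤ C * ‖q‖ ^ m.natAbs := by
  obtain ⟨B₁, hB₁0, hB₁⟩ := exists_norm_inv_one_sub_mul_pow_le x hq
  obtain ⟨B₂, hB₂0, hB₂⟩ := exists_norm_inv_one_sub_mul_pow_le x⁻¹ hq
  refine ⟨‖x‖ * B₁ + ‖x⁻¹‖ * B₂, by positivity, fun m => ?_⟩
  have hm := hxq m
  obtain ⟨n, rfl | rfl⟩ := m.eq_nat_or_neg
  · rw [if_pos (Int.natCast_nonneg n), kroneckerCoeff, Int.natAbs_natCast]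
    rw [zpow_natCast] at hm ⊢
    have h : (1 - x * q ^ n)⁻¹ - 1 = x * (1 - x * q ^ n)⁻¹ * q ^ n := by
      have : 1 - x * q ^ n ≠ 0 := sub_ne_zero.2 hm.symm
      field_simp
      ring
    rw [h, norm_mul, norm_mul, norm_pow]
    refine mul_le_mul_of_nonneg_right ?_ (by positivity)
    have := mul_le_mul_of_nonneg_left (hB₁ n) (norm_nonneg x)
    have : 0 ≤ ‖x⁻¹‖ * B₂ := by positivity
    linarith
  · rcases Nat.eq_zero_or_pos n with rfl | hn
    · rw [if_pos (by simp), kroneckerCoeff]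
      have hm' : x ≠ 1 := by simpa using hm
      have h : (1 - x * q ^ (-((0 : ℕ) : ℤ)))⁻¹ - 1 = x * (1 - x * q ^ 0)⁻¹ := by
        have : 1 - x ≠ 0 := sub_ne_zero.2 hm'.symm
        simp only [Nat.cast_zero, neg_zero, zpow_zero, pow_zero, mul_one]
        field_simp
        ring
      rw [h, norm_mul]
      have h₁ := mul_le_mul_of_nonneg_left (hB₁ 0) (norm_nonneg x)
      have h₂ : 0 ≤ ‖x⁻¹‖ * B₂ := by positivity
      simp only [Nat.cast_zero, neg_zero, Int.natAbs_zero, pow_zero, mul_one] at h₁ ⊢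
      linarith
    · rw [if_neg (by omega), kroneckerCoeff, Int.natAbs_neg, Int.natAbs_natCast, sub_zero]
      rw [zpow_neg, zpow_natCast] at hm ⊢
      have hqn : q ^ n ≠ 0 := pow_ne_zero _ hq0
      have h : (1 - x * (q ^ n)⁻¹)⁻¹ = -(x⁻¹ * (1 - x⁻¹ * q ^ n)⁻¹) * q ^ n := by
        have h1 : 1 - x * (q ^ n)⁻¹ ≠ 0 := sub_ne_zero.2 hm.symm
        have h2 : 1 - x⁻¹ * q ^ n = -(1 - x * (q ^ n)⁻¹) * (x⁻¹ * q ^ n) := by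
          field_simp
          ring
        rw [h2]
        generalize 1 - x * (q ^ n)⁻¹ = d at h1
        field_simp
      rw [h, norm_mul, norm_neg, norm_mul, norm_pow]
      refine mul_le_mul_of_nonneg_right ?_ (by positivity)
      have := mul_le_mul_of_nonneg_left (hB₂ n) (norm_nonneg x⁻¹)
      have : 0 ≤ ‖x‖ * B₁ := by positivity
      linarith

lemma norm_zpow_le_pow_natAbs {u : ℂ} {σ : ℝ} (h₁ : ‖u‖ ≤ σ) (h₂ : ‖u⁻¹‖ ≤ σ) (m : ℤ) :
    ‖u ^ m‖ ≤ σ ^ m.natAbs := by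
  obtain ⟨n, rfl | rfl⟩ := m.eq_nat_or_neg
  · simpa using pow_le_pow_left₀ (norm_nonneg _) h₁ n
  · rw [zpow_neg, ← inv_zpow, zpow_natCast, norm_pow, Int.natAbs_neg, Int.natAbs_natCast]
    exact pow_le_pow_left₀ (norm_nonneg _) h₂ n

lemma summable_pow_natAbs {r : ℝ} (h0 : 0 ≤ r) (h1 : r < 1) :
    Summable fun m : ℤ => r ^ m.natAbs :=
  .of_nat_of_neg (by simpa using summable_geometric_of_lt_one h0 h1)
    (by simpa using summable_geometric_of_lt_one h0 h1)

lemma hasSum_ite_nonneg_zpow {u : ℂ} (hu : ‖u‖ < 1) :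
    HasSum (fun m : ℤ => (if 0 ≤ m then 1 else 0) * u ^ m) (1 - u)⁻¹ := by
  have h1 : HasSum (fun n : ℕ => (if 0 ≤ (n : ℤ) then (1 : ℂ) else 0) * u ^ (n : ℤ))
      (1 - u)⁻¹ := by
    simpa using hasSum_geometric_of_norm_lt_one hu
  have h2 : HasSum (fun n : ℕ => (if 0 ≤ (-((n : ℤ) + 1)) then (1 : ℂ) else 0) *
      u ^ (-((n : ℤ) + 1))) 0 := by
    convert hasSum_zero with n
    rw [if_neg (by omega), zero_mul]
  simpa using HasSum.of_nat_of_neg_add_one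
    (f := fun m : ℤ => (if 0 ≤ m then (1 : ℂ) else 0) * u ^ m) h1 h2

/-- On annuli `σ⁻¹ ≤ |u| < 1` with `σ|q| < 1`, the Kronecker series converges absolutely and
stays within bounded distance of `1 / (1 - u)`. -/
lemma exists_norm_kroneckerSeries_sub_le {x q : ℂ} (hx : x ≠ 0) (hq0 : q ≠ 0) (hq : ‖q‖ < 1)
    (hxq : ∀ m : ℤ, x * q ^ m ≠ 1) {σ : ℝ} (hσ0 : 0 ≤ σ) (hσ : ‖q‖ * σ < 1) :
    ∃ M : ℝ, ∀ u : ℂ, ‖u‖ < 1 → ‖u‖ ≤ σ → ‖u⁻¹‖ ≤ σ →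
      (Summable fun m : ℤ => ‖kroneckerCoeff x q m * u ^ m‖) ∧
        ‖kroneckerSeries x q u - (1 - u)⁻¹‖ ≤ M := by
  obtain ⟨C, hC0, hC⟩ := exists_norm_kroneckerCoeff_sub_le hx hq0 hq hxq
  have hgeom := (summable_pow_natAbs (mul_nonneg (norm_nonneg q) hσ0) hσ).mul_left C
  refine ⟨∑' m : ℤ, C * (‖q‖ * σ) ^ m.natAbs, fun u hu h₁ h₂ => ?_⟩
  have hle : ∀ m : ℤ, ‖(kroneckerCoeff x q m - if 0 ≤ m then 1 else 0) * u ^ m‖ ≤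
      C * (‖q‖ * σ) ^ m.natAbs := by
    intro m
    rw [norm_mul, mul_pow, ← mul_assoc]
    exact mul_le_mul (hC m) (norm_zpow_le_pow_natAbs h₁ h₂ m) (norm_nonneg _) (by positivity)
  have hs : Summable fun m : ℤ =>
      ‖(kroneckerCoeff x q m - if 0 ≤ m then 1 else 0) * u ^ m‖ :=
    .of_nonneg_of_le (fun _ => norm_nonneg _) hle hgeom
  have hsplit : ∀ m : ℤ, kroneckerCoeff x q m * u ^ m =
      (kroneckerCoeff x q m - if 0 ≤ m then 1 else 0) * u ^ m +
        (if 0 ≤ m then 1 else 0) * u ^ m := by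
    intro m; ring
  have hsum : HasSum (fun m : ℤ => kroneckerCoeff x q m * u ^ m)
      ((∑' m : ℤ, (kroneckerCoeff x q m - if 0 ≤ m then 1 else 0) * u ^ m) + (1 - u)⁻¹) := by
    simp only [hsplit]
    exact hs.of_norm.hasSum.add (hasSum_ite_nonneg_zpow hu)
  refine ⟨hsum.summable.norm, ?_⟩
  rw [kroneckerSeries, hsum.tsum_eq, add_sub_cancel_right]
  exact tsum_of_norm_bounded hgeom.hasSum hle

lemma summable_norm_kroneckerCoeff_mul {x q u : ℂ} (hx : x ≠ 0) (hq0 : q ≠ 0)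
    (hxq : ∀ m : ℤ, x * q ^ m ≠ 1) (hu : ‖u‖ < 1) (hqu : ‖q‖ < ‖u‖) :
    Summable fun m : ℤ => ‖kroneckerCoeff x q m * u ^ m‖ := by
  have hu0 : 0 < ‖u‖ := (norm_nonneg q).trans_lt hqu
  have h1 : 1 ≤ ‖u⁻¹‖ := by
    rw [norm_inv]; exact (one_le_inv₀ hu0).2 hu.le
  obtain ⟨M, hM⟩ := exists_norm_kroneckerSeries_sub_le hx hq0 (hqu.trans hu) hxq
    (norm_nonneg u⁻¹) (by rw [norm_inv, ← div_eq_mul_inv]; exact (div_lt_one hu0).2 hqu)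
  exact (hM u hu (hu.le.trans h1) le_rfl).1

lemma exists_norm_kroneckerCoeff_le {x q : ℂ} (hx : x ≠ 0) (hq0 : q ≠ 0) (hq : ‖q‖ < 1)
    (hxq : ∀ m : ℤ, x * q ^ m ≠ 1) : ∃ B : ℝ, ∀ m : ℤ, ‖kroneckerCoeff x q m‖ ≤ B := by
  obtain ⟨C, hC0, hC⟩ := exists_norm_kroneckerCoeff_sub_le hx hq0 hq hxq
  refine ⟨C + 1, fun m => ?_⟩
  have h1 := norm_sub_norm_le (kroneckerCoeff x q m) (if 0 ≤ m then 1 else 0)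
  have h2 : ‖(if 0 ≤ m then 1 else 0 : ℂ)‖ ≤ 1 := by split_ifs <;> simp
  have h3 : C * ‖q‖ ^ m.natAbs ≤ C :=
    mul_le_of_le_one_right hC0 (pow_le_one₀ (norm_nonneg _) hq.le)
  linarith [hC m]

/-- The Fourier coefficients of the product of a theta series and a Kronecker series. -/
noncomputable def thetaKroneckerCoeff (τ x : ℂ) (k : ℤ) : ℂ :=
  ∑' m : ℤ, thetaCoeff τ (k - m) * kroneckerCoeff x (expTwoPiI τ) m

lemma summable_thetaKronecker {τ x : ℂ} (hτ : 0 < τ.im) (hx : x ≠ 0)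
    (hxq : ∀ m : ℤ, x * expTwoPiI τ ^ m ≠ 1) (k : ℤ) :
    Summable fun m : ℤ => thetaCoeff τ (k - m) * kroneckerCoeff x (expTwoPiI τ) m := by
  obtain ⟨B, hB⟩ := exists_norm_kroneckerCoeff_le hx (expTwoPiI_ne_zero τ)
    (norm_expTwoPiI_lt_one hτ) hxq
  have hs := ((Equiv.subLeft k).summable_iff.2 (summable_norm_thetaCoeff hτ)).mul_right B
  refine .of_norm (.of_nonneg_of_le (fun _ => norm_nonneg _) (fun m => ?_) hs)
  rw [norm_mul]
  exact mul_le_mul_of_nonneg_left (hB m) (norm_nonneg _)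

lemma hasSum_thetaCoeff_sub {τ : ℂ} (hτ : 0 < τ.im) (k : ℤ) :
    HasSum (fun m : ℤ => thetaCoeff τ (k - m)) 0 := by
  have h := (summable_norm_thetaCoeff hτ).of_norm.hasSum
  rw [tsum_thetaCoeff] at h
  exact (Equiv.subLeft k).hasSum_iff.2 h

lemma thetaKroneckerCoeff_add_one {τ x : ℂ} (hτ : 0 < τ.im) (hx : x ≠ 0)
    (hxq : ∀ m : ℤ, x * expTwoPiI τ ^ m ≠ 1) (k : ℤ) :
    thetaKroneckerCoeff τ x (k + 1) =
      -x * expTwoPiI τ ^ (k + 1) * thetaKroneckerCoeff τ x k := by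
  have hq := expTwoPiI_ne_zero τ
  have h0 := hasSum_thetaCoeff_sub hτ (k + 1)
  have hsub := (summable_thetaKronecker hτ hx hxq (k + 1)).tsum_sub h0.summable
  rw [h0.tsum_eq, sub_zero] at hsub
  rw [thetaKroneckerCoeff, thetaKroneckerCoeff, ← hsub, ← tsum_mul_left]
  refine tsum_congr fun m => ?_
  have hm : 1 - x * expTwoPiI τ ^ m ≠ 0 := sub_ne_zero.2 (hxq m).symm
  have hk : k + 1 - m = k - m + 1 := by ring
  have hg : kroneckerCoeff x (expTwoPiI τ) m - 1 =
      x * expTwoPiI τ ^ m * kroneckerCoeff x (expTwoPiI τ) m := by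
    rw [kroneckerCoeff]
    field_simp
    ring
  have hp : expTwoPiI τ ^ (k + 1) = expTwoPiI τ ^ (k - m + 1) * expTwoPiI τ ^ m := by
    rw [← zpow_add₀ hq]; congr 1; ring
  rw [← mul_sub_one, hg, hk, thetaCoeff_add_one, hp]
  generalize expTwoPiI τ ^ (k - m + 1) = a
  generalize expTwoPiI τ ^ m = b
  ring

/-- The proportionality factor between `thetaSeries τ (z + X)` and the product of the theta series
with the Kronecker series. -/
noncomputable def thetaKroneckerConst (τ x : ℂ) : ℂ :=
  thetaKroneckerCoeff τ x 0 / thetaCoeff τ 0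

lemma thetaKroneckerCoeff_eq {τ x : ℂ} (hτ : 0 < τ.im) (hx : x ≠ 0)
    (hxq : ∀ m : ℤ, x * expTwoPiI τ ^ m ≠ 1) (k : ℤ) :
    thetaKroneckerCoeff τ x k = thetaKroneckerConst τ x * (thetaCoeff τ k * x ^ k) := by
  have hstep : ∀ k : ℤ,
      thetaKroneckerCoeff τ x (k + 1) =
          thetaKroneckerConst τ x * (thetaCoeff τ (k + 1) * x ^ (k + 1)) ↔
        thetaKroneckerCoeff τ x k = thetaKroneckerConst τ x * (thetaCoeff τ k * x ^ k) := by
    intro k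
    have hne : -x * expTwoPiI τ ^ (k + 1) ≠ 0 :=
      mul_ne_zero (neg_ne_zero.2 hx) (zpow_ne_zero _ (expTwoPiI_ne_zero τ))
    rw [thetaKroneckerCoeff_add_one hτ hx hxq, thetaCoeff_add_one, zpow_add_one₀ hx,
      ← mul_right_inj' hne (b := thetaKroneckerCoeff τ x k)]
    have : thetaKroneckerConst τ x *
        (-expTwoPiI τ ^ (k + 1) * thetaCoeff τ k * (x ^ k * x)) =
      -x * expTwoPiI τ ^ (k + 1) * (thetaKroneckerConst τ x * (thetaCoeff τ k * x ^ k)) := by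
      ring
    rw [this]
  induction k using Int.induction_on with
  | zero =>
    rw [thetaKroneckerConst, zpow_zero, mul_one, div_mul_cancel₀ _ (thetaCoeff_ne_zero τ 0)]
  | succ i ih => exact (hstep _).2 ih
  | pred i ih => exact (hstep _).1 (by simpa using ih)

lemma kroneckerSeries_mul_thetaSeries {τ X z : ℂ} (hτ : 0 < τ.im)
    (hxq : ∀ m : ℤ, expTwoPiI X * expTwoPiI τ ^ m ≠ 1) (hz : 0 < z.im) (hzτ : z.im < τ.im) :
    kroneckerSeries (expTwoPiI X) (expTwoPiI τ) (expTwoPiI z) * thetaSeries τ z =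
      thetaKroneckerConst τ (expTwoPiI X) * thetaSeries τ (z + X) := by
  have hx := expTwoPiI_ne_zero X
  have hqz : ‖expTwoPiI τ‖ < ‖expTwoPiI z‖ := by
    rw [norm_expTwoPiI, norm_expTwoPiI, Real.exp_lt_exp]
    nlinarith [Real.pi_pos]
  have hsK := summable_norm_kroneckerCoeff_mul hx (expTwoPiI_ne_zero τ) hxq
    (norm_expTwoPiI_lt_one hz) hqz
  have hsT := summable_norm_thetaCoeff_mul hτ z
  have hprod := summable_mul_of_summable_norm hsK hsT
  let e : ℤ × ℤ ≃ ℤ × ℤ := (Equiv.prodShear (Equiv.refl ℤ) fun m => Equiv.subRight m)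
  have hprod' := e.summable_iff.2 hprod
  rw [kroneckerSeries, thetaSeries, tsum_mul_tsum_of_summable_norm hsK hsT, ← e.tsum_eq,
    ← (Equiv.prodComm ℤ ℤ).tsum_eq]
  refine (Summable.tsum_prod ((Equiv.prodComm ℤ ℤ).summable_iff.2 hprod')).trans ?_
  rw [thetaSeries, ← tsum_mul_left]
  refine tsum_congr fun k => ?_
  have hrhs : thetaKroneckerConst τ (expTwoPiI X) *
      (thetaCoeff τ k * expTwoPiI (k * (z + X))) =
      thetaKroneckerCoeff τ (expTwoPiI X) k * expTwoPiI z ^ k := by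
    rw [thetaKroneckerCoeff_eq hτ hx hxq, expTwoPiI_int_mul, expTwoPiI_add, mul_zpow]
    ring
  rw [hrhs, thetaKroneckerCoeff, ← tsum_mul_right]
  refine tsum_congr fun m => ?_
  have hzk : expTwoPiI z ^ k = expTwoPiI z ^ m * expTwoPiI z ^ (k - m) := by
    rw [← zpow_add₀ (expTwoPiI_ne_zero z)]; congr 1; ring
  rw [hzk, ← expTwoPiI_int_mul (k - m)]
  change kroneckerCoeff _ _ m * _ ^ m *
    (thetaCoeff τ (k - m) * expTwoPiI (((k - m : ℤ) : ℂ) * z)) = _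
  ring

lemma tendsto_thetaSeries_div {τ : ℂ} (hτ : 0 < τ.im) :
    Tendsto (fun z => (1 - expTwoPiI z)⁻¹ * thetaSeries τ z) (𝓝[≠] 0)
      (𝓝 (Complex.I / (2 * π) * deriv (thetaSeries τ) 0)) := by
  have h1 := (differentiable_thetaSeries hτ 0).hasDerivAt.tendsto_slope
  have h2 := ((hasDerivAt_expTwoPiI 0).const_sub 1).tendsto_slope
  have hne : -(2 * π * Complex.I * expTwoPiI 0) ≠ 0 := by
    simp [Real.pi_ne_zero, expTwoPiI_zero]
  have h3 := (h2.inv₀ hne).mul h1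
  have hlim : (-(2 * π * Complex.I * expTwoPiI 0))⁻¹ * deriv (thetaSeries τ) 0 =
      Complex.I / (2 * π) * deriv (thetaSeries τ) 0 := by
    have : (π : ℂ) ≠ 0 := by simp [Real.pi_ne_zero]
    rw [expTwoPiI_zero]
    congr 1
    rw [mul_one, inv_neg, mul_inv, Complex.inv_I]
    field_simp
  rw [hlim] at h3
  refine h3.congr' ?_
  filter_upwards [self_mem_nhdsWithin] with z hz
  have hz' : z ≠ 0 := hz
  simp only [slope_def_field, thetaSeries_zero, expTwoPiI_zero, sub_zero, sub_self, inv_div]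
  rw [div_mul_div_comm, mul_comm z, mul_div_mul_right _ _ hz', div_eq_inv_mul]

lemma thetaKroneckerConst_mul_thetaSeries {τ X : ℂ} (hτ : 0 < τ.im)
    (hxq : ∀ m : ℤ, expTwoPiI X * expTwoPiI τ ^ m ≠ 1) :
    thetaKroneckerConst τ (expTwoPiI X) * thetaSeries τ X =
      Complex.I / (2 * π) * deriv (thetaSeries τ) 0 := by
  set x := expTwoPiI X with hxdef
  have hcont := (differentiable_thetaSeries hτ).continuous
  let p : ℝ → ℂ := fun s => s * Complex.I
  have hp0 : Tendsto p (𝓝[>] 0) (𝓝 0) := by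
    have : Continuous p := by fun_prop
    simpa [p] using (this.tendsto 0).mono_left nhdsWithin_le_nhds
  have hp : Tendsto p (𝓝[>] 0) (𝓝[≠] 0) := by
    refine tendsto_nhdsWithin_iff.2 ⟨hp0, ?_⟩
    filter_upwards [self_mem_nhdsWithin] with s hs
    simpa [p] using (ne_of_gt hs : s ≠ 0)
  have hσ : ‖expTwoPiI τ‖ * Real.exp (π * τ.im) < 1 := by
    rw [norm_expTwoPiI, ← Real.exp_add, Real.exp_lt_one_iff]
    nlinarith [mul_pos Real.pi_pos hτ]
  obtain ⟨M, hM⟩ := exists_norm_kroneckerSeries_sub_le (expTwoPiI_ne_zero X)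
    (expTwoPiI_ne_zero τ) (norm_expTwoPiI_lt_one hτ) hxq (Real.exp_pos _).le hσ
  have hev : ∀ᶠ s : ℝ in 𝓝[>] 0, 0 < s ∧ s < τ.im / 2 :=
    Ioo_mem_nhdsGT (half_pos hτ)
  have hbd : Tendsto (fun s => (kroneckerSeries x (expTwoPiI τ) (expTwoPiI (p s)) -
      (1 - expTwoPiI (p s))⁻¹) * thetaSeries τ (p s)) (𝓝[>] 0) (𝓝 0) := by
    refine squeeze_zero_norm' (a := fun s => M * ‖thetaSeries τ (p s)‖) ?_ ?_
    · filter_upwards [hev] with s hs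
      rw [norm_mul]
      refine mul_le_mul_of_nonneg_right (hM _ ?_ ?_ ?_).2 (norm_nonneg _)
      · exact norm_expTwoPiI_lt_one (by simpa [p] using hs.1)
      · rw [norm_expTwoPiI, Real.exp_le_exp]
        simp only [p, Complex.im_ofReal_mul, Complex.I_im, mul_one]
        nlinarith [Real.pi_pos, hs.1, mul_pos Real.pi_pos hτ, mul_pos Real.pi_pos hs.1]
      · rw [← expTwoPiI_neg, norm_expTwoPiI, Real.exp_le_exp]
        simp only [p, Complex.neg_im, Complex.im_ofReal_mul, Complex.I_im, mul_one]
        nlinarith [Real.pi_pos, hs.2]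
    · have := ((hcont.tendsto 0).comp hp0).norm.const_mul M
      simpa [thetaSeries_zero] using this
  have hlim := hbd.add ((tendsto_thetaSeries_div hτ).comp hp)
  rw [zero_add] at hlim
  have hlim' : Tendsto (fun s => thetaKroneckerConst τ x * thetaSeries τ (p s + X)) (𝓝[>] 0)
      (𝓝 (thetaKroneckerConst τ x * thetaSeries τ X)) := by
    have h : Continuous fun z => thetaKroneckerConst τ x * thetaSeries τ (z + X) := by fun_prop
    simpa [Function.comp_def] using (h.tendsto 0).comp hp0
  refine tendsto_nhds_unique hlim' (hlim.congr' ?_)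
  filter_upwards [hev] with s hs
  rw [← kroneckerSeries_mul_thetaSeries hτ hxq (by simpa [p] using hs.1)
    (by simp [p]; linarith [hs.2])]
  simp only [Function.comp_apply]
  ring

lemma norm_kroneckerCoeff_le_of_norm_one {x q : ℂ} (hx : ‖x‖ = 1) (hq0 : q ≠ 0) (hq : ‖q‖ < 1)
    {m : ℤ} (hm : m ≠ 0) : ‖kroneckerCoeff x q m‖ ≤ (1 - ‖q‖)⁻¹ := by
  have hqpos : 0 < ‖q‖ := norm_pos_iff.2 hq0
  rw [kroneckerCoeff, norm_inv]
  refine inv_anti₀ (sub_pos.2 hq) ?_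
  rcases lt_or_gt_of_ne hm with h | h
  · have h1 := norm_sub_norm_le (x * q ^ m) 1
    rw [norm_sub_rev, norm_mul, hx, one_mul, norm_zpow, norm_one] at h1
    refine le_trans ?_ h1
    have h2 : (1 : ℝ) + 1 ≤ ‖q‖ ^ m + ‖q‖ := by
      have h3 : ‖q‖ ^ (-1 : ℤ) ≤ ‖q‖ ^ m :=
        zpow_le_zpow_right_of_le_one₀ hqpos hq.le (by omega)
      rw [zpow_neg_one] at h3
      have h4 : ‖q‖ * ‖q‖⁻¹ = 1 := mul_inv_cancel₀ hqpos.ne'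
      nlinarith [sq_nonneg (‖q‖ - 1), inv_pos.2 hqpos]
    linarith
  · have h1 := norm_sub_norm_le 1 (x * q ^ m)
    rw [norm_mul, hx, one_mul, norm_zpow, norm_one] at h1
    refine le_trans ?_ h1
    have h3 : ‖q‖ ^ m ≤ ‖q‖ ^ (1 : ℤ) :=
      zpow_le_zpow_right_of_le_one₀ hqpos hq.le (by omega)
    rw [zpow_one] at h3
    linarith

lemma mul_zpow_ne_one_of_norm_one {x q : ℂ} (hx : ‖x‖ = 1) (hx1 : x ≠ 1)
    (hq : ‖q‖ < 1) (m : ℤ) : x * q ^ m ≠ 1 := by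
  rcases eq_or_ne m 0 with rfl | hm
  · simpa using hx1
  · intro h
    have h1 := congrArg norm h
    rw [norm_mul, hx, one_mul, norm_zpow, norm_one,
      zpow_eq_one_iff_right₀ (norm_nonneg q) hq.ne] at h1
    exact hm h1

lemma eventually_thetaKroneckerConst_ne_zero {τ : ℂ} (hτ : 0 < τ.im) :
    ∀ᶠ X : ℝ in 𝓝[≠] 0, expTwoPiI X ≠ 1 ∧ thetaKroneckerConst τ (expTwoPiI X) ≠ 0 := by
  set q := expTwoPiI τ with hqdef
  have hq0 : q ≠ 0 := expTwoPiI_ne_zero τ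
  have hq : ‖q‖ < 1 := norm_expTwoPiI_lt_one hτ
  have hs : Summable fun m : ℤ => ‖thetaCoeff τ (0 - m)‖ * (1 - ‖q‖)⁻¹ :=
    ((Equiv.subLeft 0).summable_iff.2 (summable_norm_thetaCoeff hτ)).mul_right _
  set A := ∑' m : ℤ, ‖thetaCoeff τ (0 - m)‖ * (1 - ‖q‖)⁻¹ with hA
  have hcont : Continuous fun X : ℝ => ‖1 - expTwoPiI X‖ * A := by
    have := continuous_expTwoPiI
    fun_prop
  have hsmall : ∀ᶠ X : ℝ in 𝓝[≠] 0, ‖1 - expTwoPiI X‖ * A < ‖thetaCoeff τ 0‖ := by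
    refine ((hcont.tendsto 0).mono_left nhdsWithin_le_nhds).eventually_lt_const ?_
    simpa [expTwoPiI_zero] using thetaCoeff_ne_zero τ 0
  have hIoo : ∀ᶠ X : ℝ in 𝓝[≠] 0, X ∈ Set.Ioo (-1 : ℝ) 1 :=
    nhdsWithin_le_nhds (Ioo_mem_nhds (by norm_num) (by norm_num))
  filter_upwards [hsmall, hIoo, self_mem_nhdsWithin] with X hX hXI hX0
  have hX0' : X ≠ 0 := hX0
  have hx1 : expTwoPiI X ≠ 1 := by
    intro h
    rw [expTwoPiI, Complex.exp_eq_one_iff] at h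
    obtain ⟨n, hn⟩ := h
    have hne : 2 * (π : ℂ) * Complex.I ≠ 0 := by simp [Real.pi_ne_zero]
    have hn' : (X : ℂ) = (n : ℝ) := by
      push_cast
      exact mul_left_cancel₀ hne (by rw [hn]; ring)
    have hn'' : X = n := by exact_mod_cast hn'
    rw [hn''] at hXI hX0'
    have h1 : (-1 : ℤ) < n := by exact_mod_cast hXI.1
    have h2 : n < 1 := by exact_mod_cast hXI.2
    exact hX0' (by exact_mod_cast (by omega : n = 0))
  refine ⟨hx1, fun h => ?_⟩
  set x := expTwoPiI X with hxdef
  have hxn : ‖x‖ = 1 := norm_expTwoPiI_ofReal X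
  have hxq := mul_zpow_ne_one_of_norm_one hxn hx1 hq
  have hH : thetaKroneckerCoeff τ x 0 = 0 :=
    (div_eq_zero_iff.1 h).resolve_right (thetaCoeff_ne_zero τ 0)
  rw [thetaKroneckerCoeff,
    (summable_thetaKronecker hτ (expTwoPiI_ne_zero _) hxq 0).tsum_eq_add_tsum_ite 0] at hH
  have hbound : ‖∑' m : ℤ, (if m = 0 then 0 else thetaCoeff τ (0 - m) * kroneckerCoeff x q m)‖
      ≤ A := by
    refine tsum_of_norm_bounded hs.hasSum fun m => ?_
    split_ifs with hm
    · rw [norm_zero]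
      have := inv_nonneg.2 (sub_nonneg.2 hq.le)
      positivity
    · rw [norm_mul]
      exact mul_le_mul_of_nonneg_left (norm_kroneckerCoeff_le_of_norm_one hxn hq0 hq hm)
        (norm_nonneg _)
  have h1x : 1 - x ≠ 0 := sub_ne_zero.2 hx1.symm
  have hmain : thetaCoeff τ 0 = -(1 - x) *
      ∑' m : ℤ, (if m = 0 then 0 else thetaCoeff τ (0 - m) * kroneckerCoeff x q m) := by
    have h0 : kroneckerCoeff x q 0 = (1 - x)⁻¹ := by simp [kroneckerCoeff]
    rw [← hqdef, h0, sub_zero, ← div_eq_mul_inv] at hH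
    have := eq_neg_of_add_eq_zero_left hH
    rw [div_eq_iff h1x] at this
    rw [this]
    ring
  have hle : ‖thetaCoeff τ 0‖ ≤ ‖1 - x‖ * A := by
    rw [hmain, norm_mul, norm_neg]
    exact mul_le_mul_of_nonneg_left hbound (norm_nonneg _)
  exact absurd hX (not_lt.2 hle)

lemma deriv_thetaSeries_zero_ne_zero {τ : ℂ} (hτ : 0 < τ.im) : deriv (thetaSeries τ) 0 ≠ 0 := by
  intro h0
  have hzero : ∀ᶠ X : ℝ in 𝓝[≠] 0, thetaSeries τ X = 0 := by
    filter_upwards [eventually_thetaKroneckerConst_ne_zero hτ] with X hX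
    have h := thetaKroneckerConst_mul_thetaSeries hτ (X := X)
      (mul_zpow_ne_one_of_norm_one (norm_expTwoPiI_ofReal X) hX.1
        (norm_expTwoPiI_lt_one hτ))
    rw [h0, mul_zero] at h
    exact (mul_eq_zero.1 h).resolve_left hX.2
  have hmap : Tendsto (fun t : ℝ => (t : ℂ)) (𝓝[≠] 0) (𝓝[≠] 0) := by
    refine tendsto_nhdsWithin_iff.2 ⟨?_, ?_⟩
    · simpa using (Complex.continuous_ofReal.tendsto 0).mono_left nhdsWithin_le_nhds
    · filter_upwards [self_mem_nhdsWithin] with t ht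
      simpa using ht
  have hfreq : ∃ᶠ z : ℂ in 𝓝[≠] 0, thetaSeries τ z = 0 := hmap.frequently hzero.frequently
  have hall := AnalyticOnNhd.eqOn_zero_of_preconnected_of_frequently_eq_zero
    (fun z _ => (differentiable_thetaSeries hτ).analyticAt z) isPreconnected_univ
    (Set.mem_univ 0) hfreq
  obtain ⟨t, ht⟩ := exists_thetaSeries_ofReal_ne_zero hτ
  exact ht (hall (Set.mem_univ _))

lemma thetaSeries_ne_zero {τ X : ℂ} (hτ : 0 < τ.im)
    (hxq : ∀ m : ℤ, expTwoPiI X * expTwoPiI τ ^ m ≠ 1) : thetaSeries τ X ≠ 0 := by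
  intro h
  have h1 := thetaKroneckerConst_mul_thetaSeries hτ hxq
  rw [h, mul_zero] at h1
  refine mul_ne_zero ?_ (deriv_thetaSeries_zero_ne_zero hτ) h1.symm
  simp [Real.pi_ne_zero]

lemma expTwoPiI_mul_zpow_ne_one_of_im {τ z : ℂ} (hz : 0 < z.im) (hzτ : z.im < τ.im) (m : ℤ) :
    expTwoPiI z * expTwoPiI τ ^ m ≠ 1 := by
  intro h
  have h1 := congrArg norm h
  rw [← expTwoPiI_int_mul, ← expTwoPiI_add, norm_expTwoPiI, norm_one, Real.exp_eq_one_iff] at h1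
  have h2 : z.im + m * τ.im = 0 := by
    have := (mul_eq_zero.1 h1).resolve_left (by simp [Real.pi_ne_zero])
    simpa using this
  rcases le_or_gt 0 m with hm | hm
  · have : (0 : ℝ) ≤ m := by exact_mod_cast hm
    nlinarith
  · have : (m : ℝ) ≤ -1 := by exact_mod_cast (by omega : m ≤ -1)
    nlinarith

/-- The Kronecker series as a quotient of theta series. -/
lemma kroneckerSeries_eq {τ X z : ℂ} (hτ : 0 < τ.im)
    (hxq : ∀ m : ℤ, expTwoPiI X * expTwoPiI τ ^ m ≠ 1) (hz : 0 < z.im) (hzτ : z.im < τ.im) :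
    Complex.I / (2 * π) * deriv (thetaSeries τ) 0 * thetaSeries τ (z + X) /
      (thetaSeries τ X * thetaSeries τ z) =
      kroneckerSeries (expTwoPiI X) (expTwoPiI τ) (expTwoPiI z) := by
  have hX := thetaSeries_ne_zero hτ hxq
  have hz0 := thetaSeries_ne_zero hτ (expTwoPiI_mul_zpow_ne_one_of_im hz hzτ)
  rw [← thetaKroneckerConst_mul_thetaSeries hτ hxq, div_eq_iff (mul_ne_zero hX hz0),
    mul_left_comm, kroneckerSeries_mul_thetaSeries hτ hxq hz hzτ]
  ring

lemma jacobiTheta₁'_zero {τ : ℂ} (hτ : 0 < τ.im) :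
    deriv (fun w => jacobiTheta₁ w τ) 0 = -Complex.I * deriv (thetaSeries τ) 0 := by
  have hfun : (fun w => jacobiTheta₁ w τ) =
      fun w => -Complex.I * expTwoPiI (w / 2) * thetaSeries τ w :=
    funext fun w => jacobiTheta₁_eq_thetaSeries w τ
  have he : DifferentiableAt ℂ (fun w : ℂ => -Complex.I * expTwoPiI (w / 2)) 0 := by
    unfold expTwoPiI
    fun_prop
  rw [hfun, deriv_fun_mul he (differentiable_thetaSeries hτ 0), thetaSeries_zero]
  simp [expTwoPiI_zero]

/-- Kronecker's identity for the quotient of theta functions, in the strip `0 < Im z < Im τ`. -/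
lemma jacobiTheta₁_quotient_eq_kroneckerSeries {τ X z : ℂ} (hτ : 0 < τ.im)
    (hxq : ∀ m : ℤ, expTwoPiI X * expTwoPiI τ ^ m ≠ 1) (hz : 0 < z.im) (hzτ : z.im < τ.im) :
    Complex.I / (2 * π) * (deriv (fun w => jacobiTheta₁ w τ) 0 / jacobiTheta₁ X τ) *
      (jacobiTheta₁ (z + X) τ / jacobiTheta₁ z τ) =
      kroneckerSeries (expTwoPiI X) (expTwoPiI τ) (expTwoPiI z) := by
  rw [← kroneckerSeries_eq hτ hxq hz hzτ, jacobiTheta₁'_zero hτ, jacobiTheta₁_eq_thetaSeries,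
    jacobiTheta₁_eq_thetaSeries, jacobiTheta₁_eq_thetaSeries, add_div, expTwoPiI_add]
  have hX := thetaSeries_ne_zero hτ hxq
  have hz0 := thetaSeries_ne_zero hτ (expTwoPiI_mul_zpow_ne_one_of_im hz hzτ)
  have h1 := expTwoPiI_ne_zero (X / 2)
  have h2 := expTwoPiI_ne_zero (z / 2)
  have hI := Complex.I_ne_zero
  have hpi : (π : ℂ) ≠ 0 := by simp [Real.pi_ne_zero]
  field_simp

lemma jacobiTheta₁_quotient_add_period (τ X z : ℂ) :
    jacobiTheta₁ (z + X) τ / jacobiTheta₁ z τ =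
      expTwoPiI X * (jacobiTheta₁ (z + τ + X) τ / jacobiTheta₁ (z + τ) τ) := by
  simp only [jacobiTheta₁_eq_thetaSeries]
  rw [thetaSeries_eq_add_period τ (z + X), thetaSeries_eq_add_period τ z,
    show z + X + τ = z + τ + X by ring, add_div, add_div (z + τ), expTwoPiI_add, expTwoPiI_add,
    expTwoPiI_add]
  have h1 := expTwoPiI_ne_zero (z / 2)
  have h2 := expTwoPiI_ne_zero ((z + τ) / 2)
  have h3 := expTwoPiI_ne_zero z
  have h4 := expTwoPiI_ne_zero τ
  have hI := Complex.I_ne_zero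
  rcases eq_or_ne (thetaSeries τ (z + τ)) 0 with h | h
  · simp [h]
  · field_simp

end

/-- Fourier coefficients of the deformed kernel `K_X^{(Y)}`. -/
theorem fourier_coefficients_kernelK (ηt τt X Y : ℂ)
    (hη : 0 < ηt.im) (hητ : ηt.im < τt.im)
    (hY : jTheta₂ Y ηt ≠ 0)
    (hX : ∀ m : ℤ, Complex.exp (2 * (π : ℂ) * Complex.I * (X + (m : ℂ) * τt)) ≠ 1)
    (m : ℤ) :
    (∫ z in (-(1 / 2) : ℝ)..(1 / 2 : ℝ),
        kernelK X Y ηt τt (z : ℂ) *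
          Complex.exp (-2 * (π : ℂ) * Complex.I * (m : ℂ) * (z : ℂ)))
      = Complex.exp (2 * (π : ℂ) * Complex.I * Y) *
          Complex.exp (2 * (π : ℂ) * Complex.I * (m : ℂ) * ηt) /
          (1 - Complex.exp (2 * (π : ℂ) * Complex.I * (X + (m : ℂ) * τt))) +
        Complex.exp (-2 * (π : ℂ) * Complex.I * Y) *
          Complex.exp (-2 * (π : ℂ) * Complex.I * (m : ℂ) * ηt) /
          (1 - Complex.exp (-2 * (π : ℂ) * Complex.I * (X + (m : ℂ) * τt))) := by
  have hτ : 0 < τt.im := hη.trans hητ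
  have hxq : ∀ k : ℤ, expTwoPiI X * expTwoPiI τt ^ k ≠ 1 := by
    intro k
    rw [← expTwoPiI_int_mul, ← expTwoPiI_add]
    exact hX k
  have hneg : ∀ w : ℂ, Complex.exp (-2 * (π : ℂ) * Complex.I * w) = (expTwoPiI w)⁻¹ := by
    intro w
    rw [← expTwoPiI_neg, expTwoPiI]
    congr 1
    ring
  have hpos : ∀ w : ℂ, Complex.exp (2 * (π : ℂ) * Complex.I * w) = expTwoPiI w := fun _ => rfl
  have hnegm : ∀ w : ℂ, Complex.exp (-2 * (π : ℂ) * Complex.I * (m : ℂ) * w) =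
      expTwoPiI (-(m * w)) := by
    intro w
    rw [expTwoPiI]
    congr 1
    ring
  have hposm : Complex.exp (2 * (π : ℂ) * Complex.I * (m : ℂ) * ηt) = expTwoPiI ηt ^ m := by
    rw [← expTwoPiI_int_mul, expTwoPiI]
    congr 1
    ring
  have hsub : 0 < (τt - ηt).im ∧ (τt - ηt).im < τt.im := by
    rw [Complex.sub_im]
    constructor <;> linarith
  have hsum : ∀ w : ℂ, 0 < w.im → w.im < τt.im → Summable fun k : ℤ =>
      ‖kroneckerCoeff (expTwoPiI X) (expTwoPiI τt) k * expTwoPiI w ^ k‖ := by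
    intro w hw hwτ
    refine summable_norm_kroneckerCoeff_mul (expTwoPiI_ne_zero X) (expTwoPiI_ne_zero τt) hxq
      (norm_expTwoPiI_lt_one hw) ?_
    rw [norm_expTwoPiI, norm_expTwoPiI, Real.exp_lt_exp]
    nlinarith [Real.pi_pos]
  let b : ℤ → ℂ := fun k =>
    expTwoPiI Y * (kroneckerCoeff (expTwoPiI X) (expTwoPiI τt) k * expTwoPiI ηt ^ k) -
      (expTwoPiI Y)⁻¹ * expTwoPiI X *
        (kroneckerCoeff (expTwoPiI X) (expTwoPiI τt) k * expTwoPiI (τt - ηt) ^ k)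
  have hb : Summable fun k => ‖b k‖ :=
    (((hsum _ hη hητ).of_norm.mul_left _).sub
      ((hsum _ hsub.1 hsub.2).of_norm.mul_left _)).norm
  have hseries : ∀ (w : ℂ) (t : ℝ), kroneckerSeries (expTwoPiI X) (expTwoPiI τt)
      (expTwoPiI (t + w)) = ∑' k : ℤ, kroneckerCoeff (expTwoPiI X) (expTwoPiI τt) k *
        expTwoPiI w ^ k * expTwoPiI (k * (t : ℂ)) := by
    intro w t
    refine tsum_congr fun k => ?_
    rw [expTwoPiI_add, mul_zpow, expTwoPiI_int_mul]
    ring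
  have hsumt : ∀ (w : ℂ) (t : ℝ), 0 < w.im → w.im < τt.im → Summable fun k : ℤ =>
      kroneckerCoeff (expTwoPiI X) (expTwoPiI τt) k * expTwoPiI w ^ k *
        expTwoPiI (k * (t : ℂ)) := by
    intro w t hw hwτ
    refine .of_norm ((hsum w hw hwτ).congr fun k => ?_)
    rw [norm_mul _ (expTwoPiI (k * (t : ℂ))), ← Complex.ofReal_intCast, ← Complex.ofReal_mul,
      norm_expTwoPiI_ofReal, mul_one]
  have hker : ∀ t : ℝ, kernelK X Y ηt τt t = ∑' k : ℤ, b k * expTwoPiI (k * (t : ℂ)) := by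
    intro t
    have h₁ := jacobiTheta₁_quotient_eq_kroneckerSeries (z := t + ηt) hτ hxq
      (by simpa using hη) (by simpa using hητ)
    have h₂ := jacobiTheta₁_quotient_eq_kroneckerSeries (z := t + (τt - ηt)) hτ hxq
      (by simpa using hsub.1) (by simpa using hsub.2)
    have h₃ := jacobiTheta₁_quotient_add_period τt X (t - ηt)
    rw [show (t : ℂ) - ηt + τt = t + (τt - ηt) by ring] at h₃
    have hb' : ∑' k : ℤ, b k * expTwoPiI (k * (t : ℂ)) =
        expTwoPiI Y * kroneckerSeries (expTwoPiI X) (expTwoPiI τt) (expTwoPiI (t + ηt)) -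
          (expTwoPiI Y)⁻¹ * expTwoPiI X *
            kroneckerSeries (expTwoPiI X) (expTwoPiI τt) (expTwoPiI (t + (τt - ηt))) := by
      rw [hseries, hseries, ← tsum_mul_left, ← tsum_mul_left,
        ← ((hsumt _ t hη hητ).mul_left _).tsum_sub ((hsumt _ t hsub.1 hsub.2).mul_left _)]
      refine tsum_congr fun k => ?_
      simp only [b]
      ring
    rw [hb', ← h₁, ← h₂, kernelK, jacobiTheta₁', hneg, hpos,
      show (t : ℂ) + X + ηt = t + ηt + X by ring, show (t : ℂ) + X - ηt = t - ηt + X by ring,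
      mul_div_assoc (expTwoPiI Y), mul_div_assoc (expTwoPiI Y)⁻¹, h₃]
    ring
  simp only [hker, hnegm]
  rw [integral_tsum_mul_expTwoPiI hb m, hneg, hneg, hpos, hpos, hposm, expTwoPiI_neg,
    expTwoPiI_int_mul, expTwoPiI_add, expTwoPiI_int_mul]
  simp only [b, kroneckerCoeff]
  rw [sub_eq_add_neg τt, expTwoPiI_add, expTwoPiI_neg, mul_zpow, inv_zpow]
  have hx0 : expTwoPiI X * expTwoPiI τt ^ m ≠ 0 :=
    mul_ne_zero (expTwoPiI_ne_zero X) (zpow_ne_zero _ (expTwoPiI_ne_zero τt))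
  have hinv : (1 - (expTwoPiI X * expTwoPiI τt ^ m)⁻¹)⁻¹ =
      -(expTwoPiI X * expTwoPiI τt ^ m) * (1 - expTwoPiI X * expTwoPiI τt ^ m)⁻¹ := by
    have h : 1 - (expTwoPiI X * expTwoPiI τt ^ m)⁻¹ =
        -(1 - expTwoPiI X * expTwoPiI τt ^ m) * (expTwoPiI X * expTwoPiI τt ^ m)⁻¹ := by
      rw [neg_mul, sub_mul, mul_inv_cancel₀ hx0]
      ring
    rw [h, mul_inv, inv_inv, inv_neg]
    ring
  rw [div_eq_mul_inv, div_eq_mul_inv, hinv]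
  ring
end

section
/- Under the same hypotheses, the Fredholm determinant of 1 + K̂_X^{(Y)} (the integral operator on [-1/2,1/2] with convolution kernel K_X^{(Y)}(y-z)) equals [θ₁(X-Y; τ̃-η̃) θ₂(Y; η̃)/θ₁(X; τ̃)] · ∏_{m=1}^{∞} (1-e^{2πimτ̃}) / [(1-e^{2πimη̃})(1-e^{2πim(τ̃-η̃)})], where the Fredholm determinant is the product of the eigenvalues 1 + K_m, K_m being the m-th Fourier coefficient of K_X^{(Y)}. -/
open Complex Real BigOperators

open Filter Topology

/-- The finite `q`-Pochhammer symbol `(q; q)_n`. -/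
noncomputable def qFactorial (q : ℂ) (n : ℕ) : ℂ := ∏ i ∈ Finset.range n, (1 - q ^ (i + 1))

/-- The reciprocal of `(q; q)_m`, extended by zero to negative `m`. -/
noncomputable def invQFactorial (q : ℂ) (m : ℤ) : ℂ :=
  if 0 ≤ m then (qFactorial q m.toNat)⁻¹ else 0

lemma one_sub_pow_succ_ne_zero {q : ℂ} (hq : ‖q‖ < 1) (n : ℕ) : 1 - q ^ (n + 1) ≠ 0 := by
  intro h
  have h1 : ‖q ^ (n + 1)‖ < 1 := by
    rw [norm_pow]
    exact pow_lt_one₀ (norm_nonneg _) hq n.succ_ne_zero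
  rw [← sub_eq_zero.mp h] at h1
  simp at h1

lemma qFactorial_ne_zero {q : ℂ} (hq : ‖q‖ < 1) (n : ℕ) : qFactorial q n ≠ 0 :=
  Finset.prod_ne_zero_iff.mpr fun i _ => one_sub_pow_succ_ne_zero hq i

lemma qFactorial_succ (q : ℂ) (n : ℕ) :
    qFactorial q (n + 1) = qFactorial q n * (1 - q ^ (n + 1)) :=
  Finset.prod_range_succ _ _

lemma invQFactorial_natCast (q : ℂ) (n : ℕ) : invQFactorial q n = (qFactorial q n)⁻¹ := by
  simp [invQFactorial]

lemma invQFactorial_of_neg (q : ℂ) {m : ℤ} (hm : m < 0) : invQFactorial q m = 0 :=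
  if_neg (not_le.mpr hm)

lemma invQFactorial_sub_one {q : ℂ} (hq : ‖q‖ < 1) (m : ℤ) :
    invQFactorial q (m - 1) = (1 - q ^ m) * invQFactorial q m := by
  rcases lt_trichotomy m 0 with hm | rfl | hm
  · rw [invQFactorial_of_neg q hm, invQFactorial_of_neg q (by lia), mul_zero]
  · simp [invQFactorial_of_neg]
  · obtain ⟨n, rfl⟩ : ∃ n : ℕ, m = (n + 1 : ℕ) := ⟨(m - 1).toNat, by lia⟩
    have h1 : (((n + 1 : ℕ) : ℤ) - 1) = n := by push_cast; ring
    rw [h1, invQFactorial_natCast, invQFactorial_natCast, qFactorial_succ, zpow_natCast]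
    have := one_sub_pow_succ_ne_zero hq n
    field_simp [qFactorial_ne_zero hq n]

/-- A finite form of the Jacobi triple product identity. -/
lemma hasSum_finite_triple_product {q s v : ℂ} (hq : ‖q‖ < 1) (hs : s ≠ 0) (hsq : s ^ 2 = q)
    (hv : v ≠ 0) {T : ℤ → ℂ} (hT0 : T 0 = 1) (hT : ∀ k, T (k + 1) = v * s * q ^ k * T k) (N : ℕ) :
    HasSum (fun k : ℤ => qFactorial q (2 * N) * invQFactorial q (N - k) *
        invQFactorial q (N + k) * T k)
      (∏ n ∈ Finset.range N, (1 + v * s * q ^ n) * (1 + v⁻¹ * s * q ^ n)) := by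
  have hq0 : q ≠ 0 := hsq ▸ pow_ne_zero 2 hs
  induction N with
  | zero =>
    convert hasSum_single (0 : ℤ) _ using 1
    · simp [hT0, qFactorial, invQFactorial]
    · intro k hk
      rcases lt_or_gt_of_ne hk with h | h
      · rw [invQFactorial_of_neg q (m := ((0 : ℕ) : ℤ) + k) (by simpa using h)]; ring
      · rw [invQFactorial_of_neg q (m := ((0 : ℕ) : ℤ) - k) (by simpa using h)]; ring
  | succ N ih =>
    rw [Finset.prod_range_succ]
    have h1 := (Equiv.hasSum_iff (Equiv.subRight (1 : ℤ))).mpr ih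
    have h2 := (Equiv.hasSum_iff (Equiv.addRight (1 : ℤ))).mpr ih
    convert ((ih.mul_left (1 + q ^ (2 * N + 1))).add (h1.mul_left (v * s * q ^ N))).add
      (h2.mul_left (v⁻¹ * s * q ^ N)) using 1
    · rfl
    · funext k
      simp only [Function.comp_apply, Equiv.subRight_apply, Equiv.coe_addRight]
      have hTm : v * s * q ^ N * T (k - 1) = q ^ (N + 1) * (q ^ k)⁻¹ * T k := by
        have := hT (k - 1)
        rw [sub_add_cancel, zpow_sub_one₀ hq0] at this
        rw [this]
        have hk := zpow_ne_zero k hq0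
        field_simp
        ring
      have hTp : v⁻¹ * s * q ^ N * T (k + 1) = q ^ (N + 1) * q ^ k * T k := by
        rw [hT k, pow_succ q N, ← hsq]
        field_simp
      set A := invQFactorial q ((N : ℤ) + 1 - k) with hA
      set B := invQFactorial q ((N : ℤ) + 1 + k) with hB
      have a0 : invQFactorial q ((N + 1 : ℕ) - k) = A := by push_cast; rfl
      have b0 : invQFactorial q ((N + 1 : ℕ) + k) = B := by push_cast; rfl
      have hN : q ^ ((N : ℤ) + 1) = q ^ (N + 1) := by exact_mod_cast zpow_natCast q (N + 1)
      have a1 : invQFactorial q (N - k) = (1 - q ^ (N + 1) * (q ^ k)⁻¹) * A := by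
        have := invQFactorial_sub_one hq ((N : ℤ) + 1 - k)
        rw [← hA, zpow_sub₀ hq0, hN, div_eq_mul_inv] at this
        convert this using 2
        ring
      have b1 : invQFactorial q (N + k) = (1 - q ^ (N + 1) * q ^ k) * B := by
        have := invQFactorial_sub_one hq ((N : ℤ) + 1 + k)
        rw [← hB, zpow_add₀ hq0, hN] at this
        convert this using 2
        ring
      have a2 : invQFactorial q (N - (k + 1)) =
          (1 - q ^ N * (q ^ k)⁻¹) * ((1 - q ^ (N + 1) * (q ^ k)⁻¹) * A) := by
        have := invQFactorial_sub_one hq ((N : ℤ) - k)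
        rw [a1, zpow_sub₀ hq0, zpow_natCast, div_eq_mul_inv] at this
        convert this using 2
        ring
      have b2 : invQFactorial q (N + (k - 1)) =
          (1 - q ^ N * q ^ k) * ((1 - q ^ (N + 1) * q ^ k) * B) := by
        have := invQFactorial_sub_one hq ((N : ℤ) + k)
        rw [b1, zpow_add₀ hq0, zpow_natCast] at this
        convert this using 2
        ring
      have a3 : invQFactorial q (N - (k - 1)) = A := by rw [hA]; congr 1; ring
      have b3 : invQFactorial q (N + (k + 1)) = B := by rw [hB]; congr 1; ring
      rw [a0, b0, a1, b1, a2, b2, a3, b3, show 2 * (N + 1) = 2 * N + 1 + 1 by ring,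
        qFactorial_succ, qFactorial_succ]
      have hk := zpow_ne_zero k hq0
      set t := q ^ k
      set F := qFactorial q (2 * N)
      transitivity F * (1 + q ^ (2 * N + 1)) * ((1 - q ^ (N + 1) * t⁻¹) * A) *
          ((1 - q ^ (N + 1) * t) * B) * T k +
        F * A * ((1 - q ^ N * t) * ((1 - q ^ (N + 1) * t) * B)) * (q ^ (N + 1) * t⁻¹ * T k) +
        F * ((1 - q ^ N * t⁻¹) * ((1 - q ^ (N + 1) * t⁻¹) * A)) * B * (q ^ (N + 1) * t * T k)
      · field_simp
        ring
      · rw [← hTm, ← hTp]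
        ring
    · have hsN : (v * s * q ^ N) * (v⁻¹ * s * q ^ N) = q ^ (2 * N + 1) := by
        rw [pow_succ q (2 * N), ← hsq]
        field_simp
        ring
      linear_combination (∏ n ∈ Finset.range N, (1 + v * s * q ^ n) * (1 + v⁻¹ * s * q ^ n)) * hsN

lemma summable_const_mul_pow {q : ℂ} (hq : ‖q‖ < 1) (c : ℂ) :
    Summable fun n : ℕ => ‖c * q ^ n‖ := by
  simpa using (summable_geometric_of_lt_one (norm_nonneg _) hq).mul_left ‖c‖

lemma multipliable_one_add_const_mul_pow {q : ℂ} (hq : ‖q‖ < 1) (c : ℂ) :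
    Multipliable fun n : ℕ => 1 + c * q ^ n :=
  multipliable_one_add_of_summable (summable_const_mul_pow hq c)

lemma tprod_one_sub_pow_succ_ne_zero {q : ℂ} (hq : ‖q‖ < 1) :
    ∏' n : ℕ, (1 - q ^ (n + 1)) ≠ 0 := by
  have := tprod_one_add_ne_zero_of_summable (f := fun n : ℕ => -q * q ^ n)
    (fun n => by convert one_sub_pow_succ_ne_zero hq n using 1; ring) (summable_const_mul_pow hq _)
  convert this using 3
  ring

lemma tendsto_qFactorial {q : ℂ} (hq : ‖q‖ < 1) :
    Tendsto (qFactorial q) atTop (𝓝 (∏' n : ℕ, (1 - q ^ (n + 1)))) :=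
  (ModularForm.multipliable_one_sub_pow hq).hasProd.tendsto_prod_nat

lemma tendsto_invQFactorial {q : ℂ} (hq : ‖q‖ < 1) :
    Tendsto (invQFactorial q) atTop (𝓝 (∏' n : ℕ, (1 - q ^ (n + 1)))⁻¹) := by
  have h := ((tendsto_qFactorial hq).inv₀ (tprod_one_sub_pow_succ_ne_zero hq)).comp
    (tendsto_atTop_atTop.mpr fun b => ⟨b, fun a ha => by lia⟩ : Tendsto Int.toNat atTop atTop)
  refine h.congr' ?_
  filter_upwards [eventually_ge_atTop 0] with m hm
  simp [invQFactorial, hm]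

lemma exists_norm_invQFactorial_le {q : ℂ} (hq : ‖q‖ < 1) :
    ∃ C, ∀ m, ‖invQFactorial q m‖ ≤ C := by
  have h := ((tendsto_qFactorial hq).inv₀ (tprod_one_sub_pow_succ_ne_zero hq)).norm
  obtain ⟨C, hC⟩ := h.bddAbove_range
  have hC' : ∀ n, ‖(qFactorial q n)⁻¹‖ ≤ C := fun n => hC ⟨n, rfl⟩
  refine ⟨C, fun m => ?_⟩
  unfold invQFactorial
  split_ifs
  · exact hC' _
  · simpa using (norm_nonneg _).trans (hC' 0)

lemma exists_norm_qFactorial_le {q : ℂ} (hq : ‖q‖ < 1) : ∃ C, ∀ n, ‖qFactorial q n‖ ≤ C := by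
  obtain ⟨C, hC⟩ := (tendsto_qFactorial hq).norm.bddAbove_range
  exact ⟨C, fun n => hC ⟨n, rfl⟩⟩

lemma norm_exp_two_pi_I_mul_lt_one {τ : ℂ} (hτ : 0 < τ.im) :
    ‖Complex.exp (2 * (π : ℂ) * Complex.I * τ)‖ < 1 :=
  UpperHalfPlane.norm_exp_two_pi_I_lt_one ⟨τ, hτ⟩

/-- The Jacobi triple product identity. -/
theorem jacobiTheta₂_eq_triple_product (w : ℂ) {τ q s v : ℂ} (hτ : 0 < τ.im)
    (hq : q = Complex.exp (2 * (π : ℂ) * Complex.I * τ))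
    (hs : s = Complex.exp ((π : ℂ) * Complex.I * τ))
    (hv : v = Complex.exp (2 * (π : ℂ) * Complex.I * w)) :
    jacobiTheta₂ w τ = (∏' n : ℕ, (1 - q ^ (n + 1))) *
      ((∏' n : ℕ, (1 + v * s * q ^ n)) * ∏' n : ℕ, (1 + v⁻¹ * s * q ^ n)) := by
  have hq1 : ‖q‖ < 1 := hq ▸ norm_exp_two_pi_I_mul_lt_one hτ
  have hQ := tprod_one_sub_pow_succ_ne_zero hq1
  have hsum := fun N => (hasSum_finite_triple_product (s := s) (v := v) hq1
    (hs ▸ Complex.exp_ne_zero _)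
    (by rw [hs, hq, ← Complex.exp_nat_mul]; congr 1; push_cast; ring)
    (hv ▸ Complex.exp_ne_zero _) (T := fun k => jacobiTheta₂_term k w τ)
    (by simp [jacobiTheta₂_term]) (fun k => by
      rw [hv, hs, hq, ← Complex.exp_int_mul, jacobiTheta₂_term, jacobiTheta₂_term,
        ← Complex.exp_add, ← Complex.exp_add, ← Complex.exp_add]
      congr 1; push_cast; ring) N).tsum_eq
  obtain ⟨C, hC⟩ := exists_norm_qFactorial_le hq1
  obtain ⟨D, hD⟩ := exists_norm_invQFactorial_le hq1
  have hC0 : 0 ≤ C := (norm_nonneg _).trans (hC 0)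
  have hD0 : 0 ≤ D := (norm_nonneg _).trans (hD 0)
  have hlim := tendsto_tsum_of_dominated_convergence (𝓕 := atTop)
    (f := fun (N : ℕ) (k : ℤ) => qFactorial q (2 * N) * invQFactorial q (N - k) *
        invQFactorial q (N + k) * jacobiTheta₂_term k w τ)
    (g := fun k => (∏' n : ℕ, (1 - q ^ (n + 1)))⁻¹ * jacobiTheta₂_term k w τ)
    (bound := fun k => C * D * D * ‖jacobiTheta₂_term k w τ‖)
    (((summable_jacobiTheta₂_term_iff w τ).mpr hτ).norm.mul_left _)
    (fun k => by
      have hN : Tendsto (fun N : ℕ => (N : ℤ)) atTop atTop := tendsto_natCast_atTop_atTop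
      have h2N : Tendsto (fun N : ℕ => 2 * N) atTop atTop :=
        tendsto_id.const_mul_atTop' (by norm_num)
      have h1 := (tendsto_qFactorial hq1).comp h2N
      have h2 := (tendsto_invQFactorial hq1).comp (tendsto_atTop_add_const_right _ (-k) hN)
      have h3 := (tendsto_invQFactorial hq1).comp (tendsto_atTop_add_const_right _ k hN)
      convert ((h1.mul h2).mul h3).mul_const (jacobiTheta₂_term k w τ) using 2
      · simp [sub_eq_add_neg]
      · rw [mul_inv_cancel₀ hQ, one_mul])
    (Eventually.of_forall fun N k => by
      rw [norm_mul, norm_mul, norm_mul]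
      gcongr
      · exact hC _
      · exact hD _
      · exact hD _)
  simp_rw [hsum, tsum_mul_left] at hlim
  have hprod := ((multipliable_one_add_const_mul_pow hq1 (v * s)).hasProd.mul
    (multipliable_one_add_const_mul_pow hq1 (v⁻¹ * s)).hasProd).tendsto_prod_nat
  rw [← tendsto_nhds_unique hlim hprod, mul_inv_cancel_left₀ hQ]
  rfl

lemma jacobiTheta₁_eq_jacobiTheta₂ (z τ : ℂ) :
    jacobiTheta₁ z τ = Complex.I * Complex.exp ((π : ℂ) * Complex.I * τ / 4) *
      Complex.exp (-(π : ℂ) * Complex.I * z) * jacobiTheta₂ (z - τ / 2 + 1 / 2) τ := by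
  rw [jacobiTheta₁, jacobiTheta₂, ← (Equiv.subRight (1 : ℤ)).tsum_eq, ← tsum_mul_left,
    ← tsum_mul_left]
  refine tsum_congr fun k => ?_
  have hk : (-1 : ℂ) ^ k = Complex.exp (k * (π * Complex.I)) := by
    rw [Complex.exp_int_mul, Complex.exp_pi_mul_I]
  rw [Equiv.subRight_apply, zpow_sub_one₀ (by norm_num), hk, jacobiTheta₂_term]
  push_cast
  have h : Complex.exp (k * (π * Complex.I)) *
      Complex.exp (π * Complex.I * τ * ((k : ℂ) - 1 + 1 / 2) ^ 2) *
      Complex.exp (2 * π * Complex.I * ((k : ℂ) - 1 + 1 / 2) * z) =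
      Complex.exp (π * Complex.I * τ / 4) * Complex.exp (-π * Complex.I * z) *
      Complex.exp (2 * π * Complex.I * k * (z - τ / 2 + 1 / 2) + π * Complex.I * k ^ 2 * τ) := by
    simp only [← Complex.exp_add]
    congr 1
    ring
  rw [inv_neg, inv_one]
  linear_combination Complex.I * h

/-- The multiplicative theta function `∏_{n ≥ 0} (1 - u q ^ n) (1 - u⁻¹ q ^ (n + 1))`. -/
noncomputable def mulTheta (u q : ℂ) : ℂ :=
  (∏' n : ℕ, (1 - u * q ^ n)) * ∏' n : ℕ, (1 - u⁻¹ * q ^ (n + 1))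

lemma jacobiTheta₁_eq_mulTheta (z : ℂ) {τ : ℂ} (hτ : 0 < τ.im) :
    jacobiTheta₁ z τ = Complex.I * Complex.exp ((π : ℂ) * Complex.I * τ / 4) *
      Complex.exp (-(π : ℂ) * Complex.I * z) *
      ((∏' n : ℕ, (1 - Complex.exp (2 * (π : ℂ) * Complex.I * τ) ^ (n + 1))) *
        mulTheta (Complex.exp (2 * (π : ℂ) * Complex.I * z))
          (Complex.exp (2 * (π : ℂ) * Complex.I * τ))) := by
  rw [jacobiTheta₁_eq_jacobiTheta₂, jacobiTheta₂_eq_triple_product _ hτ rfl rfl rfl, mulTheta]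
  have h1 : Complex.exp (2 * π * Complex.I * (z - τ / 2 + 1 / 2)) *
      Complex.exp (π * Complex.I * τ) = -Complex.exp (2 * π * Complex.I * z) := by
    rw [← Complex.exp_add, ← mul_neg_one, ← Complex.exp_pi_mul_I, ← Complex.exp_add]
    congr 1
    ring
  have h2 : (Complex.exp (2 * π * Complex.I * (z - τ / 2 + 1 / 2)))⁻¹ *
      Complex.exp (π * Complex.I * τ) =
      -((Complex.exp (2 * π * Complex.I * z))⁻¹ * Complex.exp (2 * π * Complex.I * τ)) := by
    have h3 : Complex.exp (π * Complex.I * τ) * Complex.exp (π * Complex.I * τ) =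
        Complex.exp (2 * π * Complex.I * τ) := by
      rw [← Complex.exp_add]
      congr 1
      ring
    rw [← h3, ← neg_mul, ← inv_neg, ← h1]
    field_simp [Complex.exp_ne_zero]
  simp_rw [h1, h2, neg_mul, ← sub_eq_add_neg, pow_succ' _ (_ : ℕ), mul_assoc]

/-- Over `ℤ`, the product of the eigenvalues is a quotient of multiplicative theta functions. -/
lemma hasProd_one_add_eigenvalue {x y p q : ℂ} (hx : x ≠ 0) (hy : y ≠ 0) (hp : p ≠ 0) (hq : q ≠ 0)
    (hp1 : ‖p‖ < 1) (hq1 : ‖q‖ < 1) (hqp1 : ‖q / p‖ < 1) (hxq : ∀ m : ℤ, x * q ^ m ≠ 1)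
    (hxθ : mulTheta x q ≠ 0) :
    HasProd (fun m : ℤ => 1 + (y * p ^ m / (1 - x * q ^ m) +
        y⁻¹ * (p ^ m)⁻¹ / (1 - (x * q ^ m)⁻¹)))
      (mulTheta (-y) p * mulTheta (x / y) (q / p) / mulTheta x q) := by
  have key {w t : ℂ} (hw : w ≠ 0) (hw1 : w ≠ 1) (ht : t ≠ 0) :
      1 + (t / (1 - w) + t⁻¹ / (1 - w⁻¹)) = (1 - -t) * (1 - w / t) / (1 - w) := by
    have h1 : 1 - w ≠ 0 := sub_ne_zero.mpr hw1.symm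
    have h2 : w - 1 ≠ 0 := sub_ne_zero.mpr hw1
    have h3 : 1 - w⁻¹ = -(1 - w) / w := by field_simp; ring
    rw [h3]
    field_simp
    ring
  have hasProd₀ {u r : ℂ} (hr : ‖r‖ < 1) :
      HasProd (fun n : ℕ => 1 - u * r ^ n) (∏' n : ℕ, (1 - u * r ^ n)) := by
    simpa [sub_eq_add_neg] using (multipliable_one_add_const_mul_pow hr (-u)).hasProd
  have hasProd₁ {u r : ℂ} (hr : ‖r‖ < 1) :
      HasProd (fun n : ℕ => 1 - u * r ^ (n + 1)) (∏' n : ℕ, (1 - u * r ^ (n + 1))) := by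
    simpa [sub_eq_add_neg, pow_succ', mul_assoc] using
      (multipliable_one_add_const_mul_pow hr (-u * r)).hasProd
  have hx0 := left_ne_zero_of_mul hxθ
  have hx1 := right_ne_zero_of_mul hxθ
  have hpos := ((hasProd₀ (u := -y) hp1).mul (hasProd₀ (u := x / y) hqp1)).div₀ (hasProd₀ hq1) hx0
  have hneg := ((hasProd₁ (u := (-y)⁻¹) hp1).mul (hasProd₁ (u := (x / y)⁻¹) hqp1)).div₀
    (hasProd₁ hq1) hx1
  convert HasProd.of_nat_of_neg_add_one (f := fun m : ℤ => 1 + (y * p ^ m / (1 - x * q ^ m) +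
        y⁻¹ * (p ^ m)⁻¹ / (1 - (x * q ^ m)⁻¹))) (hpos.congr_fun ?_) (hneg.congr_fun ?_) using 1
  · simp only [mulTheta]
    field_simp
  · intro n
    have hw : x * q ^ n ≠ 0 := mul_ne_zero hx (pow_ne_zero n hq)
    have ht : y * p ^ n ≠ 0 := mul_ne_zero hy (pow_ne_zero n hp)
    have hw1 : x * q ^ n ≠ 1 := by simpa using hxq n
    simp only [zpow_natCast, ← mul_inv]
    rw [key hw hw1 ht, mul_div_mul_comm, ← div_pow, neg_mul]
  · intro n
    have e (a : ℂ) : a ^ (-((n : ℤ) + 1)) = (a ^ (n + 1))⁻¹ := by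
      rw [zpow_neg]
      exact_mod_cast congrArg Inv.inv (zpow_natCast a (n + 1))
    have hw : x⁻¹ * q ^ (n + 1) ≠ 0 := mul_ne_zero (inv_ne_zero hx) (pow_ne_zero _ hq)
    have ht : y⁻¹ * p ^ (n + 1) ≠ 0 := mul_ne_zero (inv_ne_zero hy) (pow_ne_zero _ hp)
    have hwi : x * (q ^ (n + 1))⁻¹ = (x⁻¹ * q ^ (n + 1))⁻¹ := by rw [mul_inv, inv_inv]
    have hti : y * (p ^ (n + 1))⁻¹ = (y⁻¹ * p ^ (n + 1))⁻¹ := by rw [mul_inv, inv_inv]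
    have hw1 : x⁻¹ * q ^ (n + 1) ≠ 1 := by
      rw [← inv_ne_one, ← hwi, ← e]
      exact hxq _
    simp only [e]
    rw [inv_inv, hwi, hti, inv_inv, add_comm (_ / _), key hw hw1 ht, mul_div_mul_comm, ← div_pow,
      inv_neg, neg_mul, inv_div_inv, inv_div]

/-- The Fredholm determinant of `1 + K̂_X^{(Y)}`, computed as the product over `ℤ` of the
eigenvalues `1 + K_m` (the `K_m` being the Fourier coefficients of `K_X^{(Y)}`), equals the
closed form `θ₁(X-Y;τ̃-η̃)θ₂(Y;η̃)/θ₁(X;τ̃) · ∏_{m≥1} (1-q^m)/((1-p^m)(1-(q/p)^m))`. -/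
theorem fredholm_determinant_kernelK (ηt τt X Y : ℂ)
    (hη : 0 < ηt.im) (hητ : ηt.im < τt.im)
    (hY : jTheta₂ Y ηt ≠ 0)
    (hXθ : jacobiTheta₁ X τt ≠ 0)
    (hX : ∀ m : ℤ, Complex.exp (2 * (π : ℂ) * Complex.I * (X + (m : ℂ) * τt)) ≠ 1) :
    (∏' m : ℤ,
        (1 + (Complex.exp (2 * (π : ℂ) * Complex.I * Y) *
                Complex.exp (2 * (π : ℂ) * Complex.I * (m : ℂ) * ηt) /
                (1 - Complex.exp (2 * (π : ℂ) * Complex.I * (X + (m : ℂ) * τt))) +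
              Complex.exp (-2 * (π : ℂ) * Complex.I * Y) *
                Complex.exp (-2 * (π : ℂ) * Complex.I * (m : ℂ) * ηt) /
                (1 - Complex.exp (-2 * (π : ℂ) * Complex.I * (X + (m : ℂ) * τt))))))
      = jacobiTheta₁ (X - Y) (τt - ηt) * jTheta₂ Y ηt / jacobiTheta₁ X τt *
          ∏' m : ℕ,
            (1 - Complex.exp (2 * (π : ℂ) * Complex.I * ((m : ℂ) + 1) * τt)) /
              ((1 - Complex.exp (2 * (π : ℂ) * Complex.I * ((m : ℂ) + 1) * ηt)) *
                (1 - Complex.exp (2 * (π : ℂ) * Complex.I * ((m : ℂ) + 1) * (τt - ηt)))) := by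
  have hσ : 0 < (τt - ηt).im := by simpa using hητ
  have hτ : 0 < τt.im := hη.trans hητ
  set x := Complex.exp (2 * π * Complex.I * X) with hx
  set y := Complex.exp (2 * π * Complex.I * Y) with hy
  set p := Complex.exp (2 * π * Complex.I * ηt) with hp
  set q := Complex.exp (2 * π * Complex.I * τt) with hq
  have hr : Complex.exp (2 * π * Complex.I * (τt - ηt)) = q / p := by
    rw [hq, hp, ← Complex.exp_sub]
    congr 1
    ring
  have hp1 : ‖p‖ < 1 := norm_exp_two_pi_I_mul_lt_one hη
  have hq1 : ‖q‖ < 1 := norm_exp_two_pi_I_mul_lt_one hτ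
  have hr1 : ‖q / p‖ < 1 := hr ▸ norm_exp_two_pi_I_mul_lt_one hσ
  have hxm (m : ℤ) : Complex.exp (2 * π * Complex.I * (X + m * τt)) = x * q ^ m := by
    rw [hx, hq, ← Complex.exp_int_mul, ← Complex.exp_add]
    congr 1
    ring
  have hxm' (m : ℤ) : Complex.exp (-2 * π * Complex.I * (X + m * τt)) = (x * q ^ m)⁻¹ := by
    rw [← hxm, ← Complex.exp_neg]
    congr 1
    ring
  have hpm (m : ℤ) : Complex.exp (2 * π * Complex.I * m * ηt) = p ^ m := by
    rw [hp, ← Complex.exp_int_mul]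
    congr 1
    ring
  have hpm' (m : ℤ) : Complex.exp (-2 * π * Complex.I * m * ηt) = (p ^ m)⁻¹ := by
    rw [← hpm, ← Complex.exp_neg]
    congr 1
    ring
  have hy' : Complex.exp (-2 * π * Complex.I * Y) = y⁻¹ := by
    rw [hy, ← Complex.exp_neg]
    congr 1
    ring
  have hpow (m : ℕ) (τ : ℂ) : Complex.exp (2 * π * Complex.I * ((m : ℂ) + 1) * τ) =
      Complex.exp (2 * π * Complex.I * τ) ^ (m + 1) := by
    rw [← Complex.exp_nat_mul]
    congr 1
    push_cast
    ring
  have hQp := tprod_one_sub_pow_succ_ne_zero hp1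
  have hQq := tprod_one_sub_pow_succ_ne_zero hq1
  have hQr := tprod_one_sub_pow_succ_ne_zero hr1
  have hθX := jacobiTheta₁_eq_mulTheta X hτ
  have hθXY := jacobiTheta₁_eq_mulTheta (X - Y) hσ
  have hθY := jacobiTheta₁_eq_mulTheta (Y + 1 / 2) hη
  have hxy : Complex.exp (2 * π * Complex.I * (X - Y)) = x / y := by
    rw [hx, hy, ← Complex.exp_sub]
    congr 1
    ring
  have hyn : Complex.exp (2 * π * Complex.I * (Y + 1 / 2)) = -y := by
    rw [hy, ← mul_neg_one, ← Complex.exp_pi_mul_I, ← Complex.exp_add]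
    congr 1
    ring
  rw [hr, hxy] at hθXY
  rw [hyn, ← hp] at hθY
  rw [← hx, ← hq] at hθX
  have hxθ : mulTheta x q ≠ 0 := fun h => hXθ (by rw [hθX, h]; ring)
  have hnat : ∏' m : ℕ, (1 - q ^ (m + 1)) / ((1 - p ^ (m + 1)) * (1 - (q / p) ^ (m + 1))) =
      (∏' m : ℕ, (1 - q ^ (m + 1))) /
        ((∏' m : ℕ, (1 - p ^ (m + 1))) * ∏' m : ℕ, (1 - (q / p) ^ (m + 1))) :=
    ((ModularForm.multipliable_one_sub_pow hq1).hasProd.div₀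
      ((ModularForm.multipliable_one_sub_pow hp1).hasProd.mul
        (ModularForm.multipliable_one_sub_pow hr1).hasProd) (mul_ne_zero hQp hQr)).tprod_eq
  have hexp : Complex.I * Complex.exp (π * Complex.I * (τt - ηt) / 4) *
      Complex.exp (-π * Complex.I * (X - Y)) *
      (Complex.I * Complex.exp (π * Complex.I * ηt / 4) *
        Complex.exp (-π * Complex.I * (Y + 1 / 2))) =
      Complex.I * Complex.exp (π * Complex.I * τt / 4) * Complex.exp (-π * Complex.I * X) := by
    have h1 : Complex.exp (-(π / 2 * Complex.I)) = -Complex.I := by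
      rw [Complex.exp_neg, Complex.exp_pi_div_two_mul_I, Complex.inv_I]
    have h2 : Complex.exp (π * Complex.I * (τt - ηt) / 4) *
        Complex.exp (-π * Complex.I * (X - Y)) * Complex.exp (π * Complex.I * ηt / 4) *
        Complex.exp (-π * Complex.I * (Y + 1 / 2)) =
        Complex.exp (π * Complex.I * τt / 4) * Complex.exp (-π * Complex.I * X) *
          Complex.exp (-(π / 2 * Complex.I)) := by
      simp only [← Complex.exp_add]
      congr 1
      ring
    rw [h1] at h2
    linear_combination Complex.I ^ 2 * h2 - Complex.I * Complex.exp (π * Complex.I * τt / 4) *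
      Complex.exp (-π * Complex.I * X) * Complex.I_sq
  have hprod := (hasProd_one_add_eigenvalue (Complex.exp_ne_zero _) (Complex.exp_ne_zero _)
    (Complex.exp_ne_zero _) (Complex.exp_ne_zero _) hp1 hq1 hr1 (fun m => hxm m ▸ hX m)
    hxθ (x := x) (y := y) (p := p) (q := q)).tprod_eq
  simp only [hxm, hxm', hpm, hpm', hy', hpow, hr]
  rw [hprod, hnat, jTheta₂, hθX, hθXY, hθY, ← hexp]
  field_simp [Complex.exp_ne_zero]
end

section
/- The density ρ(z) = ∑_{m∈ℤ} e^{2πimz}/(2cosh(iπmη̃)) satisfies the Lieb integral equation ρ(z) + ∫_{-1/2}^{1/2} K(z-w)ρ(w)dw = p₀'(z)/(2π), where p₀'(z) = i[θ₁'(z+η̃/2;τ̃)/θ₁(z+η̃/2;τ̃) - θ₁'(z-η̃/2;τ̃)/θ₁(z-η̃/2;τ̃)] and K(z) = (i/2π)[θ₁'(z+η̃;τ̃)/θ₁(z+η̃;τ̃) - θ₁'(z-η̃;τ̃)/θ₁(z-η̃;τ̃)]. -/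
open Complex Real BigOperators

/-- The ground-state density `ρ(z) = ∑_{m∈ℤ} e^{2πimz}/(2 cosh(iπm η̃))`. -/
noncomputable def densityρ (ηt : ℂ) (z : ℝ) : ℂ :=
  ∑' m : ℤ, Complex.exp (2 * (π : ℂ) * Complex.I * (m : ℂ) * (z : ℂ)) /
    (2 * Complex.cosh ((π : ℂ) * Complex.I * (m : ℂ) * ηt))

section

open Filter Topology MeasureTheory

/-- The infinite `q`-Pochhammer symbol `(x; q)_∞`. -/
noncomputable def qPochhammer (q x : ℂ) : ℂ := ∏' n : ℕ, (1 - x * q ^ n)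

/-- The finite `q`-Pochhammer symbol `(q; q)_n`. -/
noncomputable def qPochhammerFinite (q : ℂ) (n : ℕ) : ℂ := ∏ i ∈ Finset.range n, (1 - q * q ^ i)

/-- The inverse `1 / (q; q)_n`, extended by zero to negative `n`. -/
noncomputable def invQPochhammer (q : ℂ) (n : ℤ) : ℂ :=
  if n < 0 then 0 else (qPochhammerFinite q n.toNat)⁻¹

lemma one_sub_mul_pow_ne_zero {q x : ℂ} (hq : ‖q‖ < 1) (hx : ‖x‖ < 1) (n : ℕ) :
    1 - x * q ^ n ≠ 0 := by
  intro h
  have h1 : ‖x * q ^ n‖ = 1 := by rw [← sub_eq_zero.mp h, norm_one]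
  have h2 : ‖x * q ^ n‖ ≤ ‖x‖ := by
    rw [norm_mul, norm_pow]
    exact mul_le_of_le_one_right (norm_nonneg _) (pow_le_one₀ (norm_nonneg _) hq.le)
  linarith

lemma summable_norm_neg_mul_pow {q : ℂ} (hq : ‖q‖ < 1) (x : ℂ) :
    Summable fun n : ℕ => ‖-(x * q ^ n)‖ := by
  simpa using (summable_geometric_of_lt_one (norm_nonneg q) hq).mul_left ‖x‖

lemma multipliable_one_sub_mul_pow {q : ℂ} (hq : ‖q‖ < 1) (x : ℂ) :
    Multipliable fun n : ℕ => 1 - x * q ^ n := by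
  simpa [sub_eq_add_neg] using multipliable_one_add_of_summable (summable_norm_neg_mul_pow hq x)

lemma tendsto_prod_qPochhammer {q : ℂ} (hq : ‖q‖ < 1) (x : ℂ) :
    Tendsto (fun N => ∏ i ∈ Finset.range N, (1 - x * q ^ i)) atTop (𝓝 (qPochhammer q x)) :=
  (multipliable_one_sub_mul_pow hq x).hasProd.tendsto_prod_nat

lemma qPochhammer_ne_zero {q x : ℂ} (hq : ‖q‖ < 1) (hx : ‖x‖ < 1) : qPochhammer q x ≠ 0 := by
  have := tprod_one_add_ne_zero_of_summable (f := fun n : ℕ => -(x * q ^ n))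
    (fun n => by simpa [← sub_eq_add_neg] using one_sub_mul_pow_ne_zero hq hx n)
    (summable_norm_neg_mul_pow hq x)
  simpa [qPochhammer, sub_eq_add_neg] using this

lemma qPochhammerFinite_ne_zero {q : ℂ} (hq : ‖q‖ < 1) (n : ℕ) : qPochhammerFinite q n ≠ 0 :=
  Finset.prod_ne_zero_iff.mpr fun i _ => one_sub_mul_pow_ne_zero hq hq i

lemma invQPochhammer_sub_one {q : ℂ} (hq : ‖q‖ < 1) (n : ℤ) :
    invQPochhammer q (n - 1) = (1 - q ^ n) * invQPochhammer q n := by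
  rcases lt_trichotomy n 0 with h | rfl | h
  · simp [invQPochhammer, h, show n - 1 < 0 by omega]
  · simp [invQPochhammer]
  · obtain ⟨m, rfl⟩ : ∃ m : ℕ, n = m + 1 := ⟨(n - 1).toNat, by omega⟩
    have hm := one_sub_mul_pow_ne_zero hq hq m
    have h1 : ¬ ((m : ℤ) + 1 < 0) := by omega
    have h2 : ((m : ℤ) + 1).toNat = m + 1 := by omega
    have h3 : q ^ ((m : ℤ) + 1) = q * q ^ m := by exact_mod_cast pow_succ' q m
    simp only [invQPochhammer, add_sub_cancel_right, h1, h2, h3, qPochhammerFinite,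
      Finset.prod_range_succ, mul_inv, if_false]
    simp [show ¬ ((m : ℤ) < 0) by omega]
    field_simp

lemma tendsto_invQPochhammer {q : ℂ} (hq : ‖q‖ < 1) :
    Tendsto (fun n : ℕ => invQPochhammer q n) atTop (𝓝 (qPochhammer q q)⁻¹) := by
  have := (tendsto_prod_qPochhammer hq q).inv₀ (qPochhammer_ne_zero hq hq)
  simpa [invQPochhammer, qPochhammerFinite, not_lt.mpr (Int.natCast_nonneg _)] using this

lemma exists_norm_invQPochhammer_le {q : ℂ} (hq : ‖q‖ < 1) :
    ∃ C : ℝ, 0 ≤ C ∧ ∀ n : ℤ, ‖invQPochhammer q n‖ ≤ C := by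
  obtain ⟨C, hC⟩ := (Metric.isBounded_range_of_tendsto _ (tendsto_invQPochhammer hq)).exists_norm_le
  have hC' (n : ℕ) : ‖invQPochhammer q n‖ ≤ C := hC _ ⟨n, rfl⟩
  have h0 : 0 ≤ C := (norm_nonneg _).trans (hC' 0)
  refine ⟨C, h0, fun n => ?_⟩
  rcases lt_or_ge n 0 with h | h
  · simpa [invQPochhammer, h] using h0
  · lift n to ℕ using h
    exact hC' n

/-- The coefficients of the finite Jacobi triple product. -/
noncomputable def tripleCoeff (s : ℂ) (N : ℕ) (k : ℤ) : ℂ :=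
  qPochhammerFinite (s ^ 2) (2 * N) * invQPochhammer (s ^ 2) (N + k) *
    invQPochhammer (s ^ 2) (N - k) * ((-1) ^ k * s ^ (k * (k - 1)))

lemma tripleCoeff_succ {s : ℂ} (hs0 : s ≠ 0) (hs : ‖s ^ 2‖ < 1) (N : ℕ) (k : ℤ) :
    tripleCoeff s (N + 1) k = tripleCoeff s N k * (1 + (s ^ 2) ^ (2 * N + 1))
      - (s ^ 2) ^ N * tripleCoeff s N (k - 1) - (s ^ 2) ^ (N + 1) * tripleCoeff s N (k + 1) := by
  have hq0 : s ^ 2 ≠ 0 := pow_ne_zero 2 hs0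
  set A := invQPochhammer (s ^ 2) (N + 1 + k) with hA
  set B := invQPochhammer (s ^ 2) (N + 1 - k) with hB
  have a1 : invQPochhammer (s ^ 2) (N + k) = (1 - (s ^ 2) ^ ((N : ℤ) + 1 + k)) * A := by
    rw [hA, ← invQPochhammer_sub_one hs]; congr 1; ring
  have b1 : invQPochhammer (s ^ 2) (N - k) = (1 - (s ^ 2) ^ ((N : ℤ) + 1 - k)) * B := by
    rw [hB, ← invQPochhammer_sub_one hs]; congr 1; ring
  have a2 : invQPochhammer (s ^ 2) (N + (k - 1)) = (1 - (s ^ 2) ^ ((N : ℤ) + k)) *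
      ((1 - (s ^ 2) ^ ((N : ℤ) + 1 + k)) * A) := by
    rw [← a1, ← invQPochhammer_sub_one hs]; congr 1; ring
  have b2 : invQPochhammer (s ^ 2) (N - (k + 1)) = (1 - (s ^ 2) ^ ((N : ℤ) - k)) *
      ((1 - (s ^ 2) ^ ((N : ℤ) + 1 - k)) * B) := by
    rw [← b1, ← invQPochhammer_sub_one hs]; congr 1; ring
  have a3 : invQPochhammer (s ^ 2) (N + (k + 1)) = A := by rw [hA]; congr 1; ring
  have b3 : invQPochhammer (s ^ 2) (N - (k - 1)) = B := by rw [hB]; congr 1; ring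
  have e : qPochhammerFinite (s ^ 2) (2 * (N + 1)) = qPochhammerFinite (s ^ 2) (2 * N) *
      (1 - s ^ 2 * (s ^ 2) ^ (2 * N)) * (1 - s ^ 2 * (s ^ 2) ^ (2 * N + 1)) := by
    rw [show 2 * (N + 1) = 2 * N + 1 + 1 by ring]
    simp only [qPochhammerFinite, Finset.prod_range_succ]
  have p1 : s ^ ((k - 1) * (k - 1 - 1)) = s ^ (k * (k - 1)) * s ^ 2 * ((s ^ 2) ^ k)⁻¹ := by
    rw [show (k - 1) * (k - 1 - 1) = k * (k - 1) + 2 - 2 * k by ring, zpow_sub₀ hs0, zpow_add₀ hs0,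
      zpow_mul s 2 k, div_eq_mul_inv]
    norm_cast
  have p2 : s ^ ((k + 1) * (k + 1 - 1)) = s ^ (k * (k - 1)) * (s ^ 2) ^ k := by
    rw [show (k + 1) * (k + 1 - 1) = k * (k - 1) + 2 * k by ring, zpow_add₀ hs0, zpow_mul s 2 k]
    simp [zpow_ofNat]
  have m1 : (-1 : ℂ) ^ (k - 1) = -(-1) ^ k := by
    rw [zpow_sub₀ (by norm_num)]; simp [div_neg]
  have m2 : (-1 : ℂ) ^ (k + 1) = -(-1) ^ k := by
    rw [zpow_add₀ (by norm_num)]; simp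
  unfold tripleCoeff
  push_cast
  rw [← hA, ← hB, a1, b1, a2, b2, a3, b3, e, p1, p2, m1, m2]
  simp only [zpow_add₀ hq0, zpow_sub₀ hq0, zpow_natCast, zpow_one]
  have hk : (s ^ 2) ^ k ≠ 0 := zpow_ne_zero _ hq0
  generalize (s ^ 2) ^ k = v at *
  generalize s ^ 2 = q at *
  rw [pow_succ q (2 * N), pow_succ q N, mul_comm 2 N, pow_mul]
  generalize q ^ N = u
  generalize s ^ (k * (k - 1)) = w
  field_simp
  ring

lemma hasSum_tripleCoeff {s y : ℂ} (hs0 : s ≠ 0) (hs : ‖s ^ 2‖ < 1) (hy : y ≠ 0) (N : ℕ) :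
    HasSum (fun k : ℤ => tripleCoeff s N k * y ^ k)
      ((∏ i ∈ Finset.range N, (1 - s ^ 2 / y * (s ^ 2) ^ i)) *
        ∏ i ∈ Finset.range N, (1 - y * (s ^ 2) ^ i)) := by
  induction N with
  | zero =>
    have h : ∀ k : ℤ, k ≠ 0 → tripleCoeff s 0 k * y ^ k = 0 := by
      intro k hk
      rcases lt_or_gt_of_ne hk with h | h
      · simp [tripleCoeff, invQPochhammer, h]
      · simp [tripleCoeff, invQPochhammer, h]
    convert hasSum_single (0 : ℤ) h using 1
    simp [tripleCoeff, invQPochhammer, qPochhammerFinite]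
  | succ N ih =>
    have h1 := ((Equiv.addRight (-1 : ℤ)).hasSum_iff.mpr ih).mul_left ((s ^ 2) ^ N * y)
    have h2 := ((Equiv.addRight (1 : ℤ)).hasSum_iff.mpr ih).mul_left ((s ^ 2) ^ (N + 1) / y)
    have h3 := ((ih.mul_right (1 + (s ^ 2) ^ (2 * N + 1))).sub h1).sub h2
    convert! h3 using 1
    · funext k
      simp only [Function.comp, Equiv.coe_addRight, ← sub_eq_add_neg, tripleCoeff_succ hs0 hs,
        zpow_sub₀ hy, zpow_add₀ hy, zpow_one]
      field_simp
    · rw [Finset.prod_range_succ, Finset.prod_range_succ]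
      field_simp
      ring

/-- The Jacobi triple product identity. -/
lemma jacobi_triple_product {s y : ℂ} (hs0 : s ≠ 0) (hs : ‖s ^ 2‖ < 1) (hy : y ≠ 0)
    (hsum : Summable fun k : ℤ => (-1) ^ k * s ^ (k * (k - 1)) * y ^ k) :
    ∑' k : ℤ, (-1) ^ k * s ^ (k * (k - 1)) * y ^ k =
      qPochhammer (s ^ 2) (s ^ 2) * (qPochhammer (s ^ 2) (s ^ 2 / y) * qPochhammer (s ^ 2) y) := by
  set D := qPochhammer (s ^ 2) (s ^ 2) with hD
  have hD0 : D ≠ 0 := qPochhammer_ne_zero hs hs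
  obtain ⟨C, hC0, hC⟩ := exists_norm_invQPochhammer_le hs
  have hE : Tendsto (fun N => qPochhammerFinite (s ^ 2) (2 * N)) atTop (𝓝 D) :=
    (tendsto_prod_qPochhammer hs (s ^ 2)).comp (tendsto_id.const_mul_atTop' two_pos)
  obtain ⟨C', hC'⟩ := (Metric.isBounded_range_of_tendsto _ hE).exists_norm_le
  replace hC' (N : ℕ) : ‖qPochhammerFinite (s ^ 2) (2 * N)‖ ≤ C' := hC' _ ⟨N, rfl⟩
  have hC'0 : 0 ≤ C' := (norm_nonneg _).trans (hC' 0)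
  have key := tendsto_tsum_of_dominated_convergence (𝓕 := atTop)
    (f := fun (N : ℕ) (k : ℤ) => tripleCoeff s N k * y ^ k)
    (g := fun k : ℤ => D⁻¹ * ((-1) ^ k * s ^ (k * (k - 1)) * y ^ k))
    (bound := fun k => C' * C * C * ‖(-1) ^ k * s ^ (k * (k - 1)) * y ^ k‖)
    (hsum.norm.mul_left _) (fun k => ?_) (Eventually.of_forall fun N k => ?_)
  · have lim := (tendsto_prod_qPochhammer hs (s ^ 2 / y)).mul (tendsto_prod_qPochhammer hs y)
    have := tendsto_nhds_unique lim
      (key.congr fun N => (hasSum_tripleCoeff hs0 hs hy N).tsum_eq)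
    rw [this, tsum_mul_left, mul_inv_cancel_left₀ hD0]
  · have hplus (j : ℤ) : Tendsto (fun N : ℕ => invQPochhammer (s ^ 2) (N + j)) atTop (𝓝 D⁻¹) := by
      have ht : Tendsto (fun N : ℕ => ((N : ℤ) + j).toNat) atTop atTop :=
        tendsto_atTop.mpr fun b => (eventually_ge_atTop (b + j.natAbs)).mono fun N hN => by omega
      refine ((tendsto_invQPochhammer hs).comp ht).congr' ?_
      filter_upwards [eventually_ge_atTop j.natAbs] with N hN
      simp only [Function.comp]
      congr 1
      omega
    have h1 := hplus k
    have h2 : Tendsto (fun N : ℕ => invQPochhammer (s ^ 2) (N - k)) atTop (𝓝 D⁻¹) := hplus (-k)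
    have h3 := (((hE.mul h1).mul h2).mul_const ((-1) ^ k * s ^ (k * (k - 1)))).mul_const (y ^ k)
    rwa [mul_inv_cancel₀ hD0, one_mul, mul_assoc] at h3
  · simp only [tripleCoeff, mul_assoc, norm_mul]
    gcongr
    exacts [hC' N, hC _, hC _]

lemma multipliableLocallyUniformlyOn_qPochhammer {q : ℂ} (hq : ‖q‖ < 1) :
    MultipliableLocallyUniformlyOn (fun (n : ℕ) (x : ℂ) => 1 - x * q ^ n) (Metric.ball 0 1) := by
  simp only [sub_eq_add_neg]
  refine Summable.multipliableLocallyUniformlyOn_nat_one_add Metric.isOpen_ball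
    (summable_geometric_of_lt_one (norm_nonneg q) hq) (.of_forall fun n x hx => ?_)
    (fun n => by fun_prop)
  rw [norm_neg, norm_mul, norm_pow]
  exact mul_le_of_le_one_left (by positivity) (by simpa using (mem_ball_zero_iff.mp hx).le)

lemma differentiableAt_qPochhammer {q x : ℂ} (hq : ‖q‖ < 1) (hx : ‖x‖ < 1) :
    DifferentiableAt ℂ (qPochhammer q) x :=
  ((multipliableLocallyUniformlyOn_qPochhammer hq).hasProdLocallyUniformlyOn.differentiableOn
    (.of_forall fun _ => by simpa [Finset.prod_fn] using
      DifferentiableOn.finsetProd (fun _ _ => by fun_prop)) Metric.isOpen_ball).differentiableAt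
    (Metric.isOpen_ball.mem_nhds (mem_ball_zero_iff.mpr hx))

lemma summable_mul_pow_pow {q x : ℂ} (hq : ‖q‖ < 1) (hx : ‖x‖ < 1) :
    Summable fun p : ℕ × ℕ => (x * q ^ p.1) ^ (p.2 + 1) := by
  have h := Summable.mul_of_nonneg (summable_geometric_of_lt_one (norm_nonneg q) hq)
    (summable_geometric_of_lt_one (norm_nonneg x) hx) (fun _ => by positivity)
    (fun _ => by positivity)
  refine h.of_norm_bounded fun p => ?_
  rw [norm_pow, norm_mul, norm_pow, mul_pow, mul_comm]
  have h1 : (‖q‖ ^ p.1) ^ (p.2 + 1) ≤ ‖q‖ ^ p.1 :=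
    pow_le_of_le_one (by positivity) (pow_le_one₀ (norm_nonneg _) hq.le) (by omega)
  have h2 : ‖x‖ ^ (p.2 + 1) ≤ ‖x‖ ^ p.2 :=
    pow_le_pow_of_le_one (norm_nonneg _) hx.le (by omega)
  gcongr

lemma hasSum_logDeriv_qPochhammer {q x : ℂ} (hq : ‖q‖ < 1) (hx : ‖x‖ < 1) :
    HasSum (fun m : ℕ => x ^ (m + 1) / (1 - q ^ (m + 1))) (-(x * logDeriv (qPochhammer q) x)) := by
  have hs := summable_mul_pow_pow hq hx
  have hinner (n : ℕ) : HasSum (fun m : ℕ => (x * q ^ n) ^ (m + 1))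
      (x * q ^ n / (1 - x * q ^ n)) := by
    have hn : ‖x * q ^ n‖ < 1 := by
      rw [norm_mul, norm_pow]
      exact (mul_le_of_le_one_right (norm_nonneg _)
        (pow_le_one₀ (norm_nonneg _) hq.le)).trans_lt hx
    simpa [pow_succ', div_eq_mul_inv] using
      (hasSum_geometric_of_norm_lt_one hn).mul_left (x * q ^ n)
  have hld (n : ℕ) : x * logDeriv (fun x : ℂ => 1 - x * q ^ n) x =
      -(x * q ^ n / (1 - x * q ^ n)) := by
    have : HasDerivAt (fun x : ℂ => 1 - x * q ^ n) (-(1 * q ^ n)) x :=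
      ((hasDerivAt_id x).mul_const (q ^ n)).const_sub 1
    rw [logDeriv_apply, this.deriv]
    ring
  have hrow := hs.hasSum.prod_fiberwise hinner
  have hsum : Summable fun n : ℕ => logDeriv (fun x : ℂ => 1 - x * q ^ n) x := by
    have hg := (summable_geometric_of_lt_one (norm_nonneg q) hq).mul_left (1 / (1 - ‖x‖))
    refine hg.of_norm_bounded fun n => ?_
    have : HasDerivAt (fun x : ℂ => 1 - x * q ^ n) (-(1 * q ^ n)) x :=
      ((hasDerivAt_id x).mul_const (q ^ n)).const_sub 1
    rw [logDeriv_apply, this.deriv, norm_div, norm_neg, one_mul, norm_pow, div_mul_eq_mul_div,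
      one_mul]
    have hx' : 0 < 1 - ‖x‖ := by linarith
    gcongr
    have h1 := norm_sub_norm_le (1 : ℂ) (x * q ^ n)
    have h2 : ‖x * q ^ n‖ ≤ ‖x‖ := by
      rw [norm_mul, norm_pow]
      exact mul_le_of_le_one_right (norm_nonneg _) (pow_le_one₀ (norm_nonneg _) hq.le)
    rw [norm_one] at h1
    linarith
  have hlog : logDeriv (qPochhammer q) x =
      ∑' n : ℕ, logDeriv (fun x : ℂ => 1 - x * q ^ n) x :=
    logDeriv_tprod_eq_tsum Metric.isOpen_ball (mem_ball_zero_iff.mpr hx)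
      (one_sub_mul_pow_ne_zero hq hx) (fun n => by fun_prop) hsum
      (multipliableLocallyUniformlyOn_qPochhammer hq) (qPochhammer_ne_zero hq hx)
  have htot : -(x * logDeriv (qPochhammer q) x) = ∑' p : ℕ × ℕ, (x * q ^ p.1) ^ (p.2 + 1) := by
    rw [hlog, ← tsum_mul_left, tsum_congr hld, tsum_neg, neg_neg, hrow.tsum_eq]
  rw [htot]
  have hcol (m : ℕ) : HasSum (fun n : ℕ => (x * q ^ n) ^ (m + 1))
      (x ^ (m + 1) / (1 - q ^ (m + 1))) := by
    have hm : ‖q ^ (m + 1)‖ < 1 := by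
      rw [norm_pow]; exact pow_lt_one₀ (norm_nonneg _) hq (by omega)
    have := (hasSum_geometric_of_norm_lt_one hm).mul_left (x ^ (m + 1))
    simpa only [mul_pow, ← pow_mul, mul_comm, div_eq_mul_inv] using this
  exact ((Equiv.prodComm ℕ ℕ).hasSum_iff.mpr hs.hasSum).prod_fiberwise hcol

lemma norm_exp_two_pi_mul_I_lt_one {w : ℂ} (hw : 0 < w.im) : ‖cexp (2 * π * I * w)‖ < 1 := by
  rw [Complex.norm_exp, Real.exp_lt_one_iff]
  have : (2 * π * I * w).re = -(2 * π * w.im) := by simp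
  rw [this]
  have := mul_pos Real.two_pi_pos hw
  linarith

lemma exp_pi_mul_I_sq (τ : ℂ) : cexp (π * I * τ) ^ 2 = cexp (2 * π * I * τ) := by
  rw [← Complex.exp_nat_mul]
  congr 1
  push_cast
  ring

lemma neg_one_zpow_eq_exp (k : ℤ) : (-1 : ℂ) ^ k = cexp (k * (π * I)) := by
  rw [Complex.exp_int_mul, exp_pi_mul_I]

lemma jacobiTheta₁_eq_qPochhammer {τ : ℂ} (hτ : 0 < τ.im) (z : ℂ) :
    jacobiTheta₁ z τ = -I * cexp (π * I * τ / 4) *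
      qPochhammer (cexp (2 * π * I * τ)) (cexp (2 * π * I * τ)) * (cexp (π * I * z) *
        (qPochhammer (cexp (2 * π * I * τ)) (cexp (2 * π * I * (τ + z))) *
          qPochhammer (cexp (2 * π * I * τ)) (cexp (2 * π * I * (-z))))) := by
  have hterm (k : ℤ) : (-1) ^ k * cexp (π * I * τ) ^ (k * (k - 1)) * cexp (2 * π * I * (-z)) ^ k =
      jacobiTheta₂_term k (1 / 2 - τ / 2 - z) τ := by
    rw [neg_one_zpow_eq_exp, ← Complex.exp_int_mul, ← Complex.exp_int_mul, ← Complex.exp_add,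
      ← Complex.exp_add, jacobiTheta₂_term]
    congr 1
    push_cast
    ring
  have hsum := (summable_jacobiTheta₂_term_iff (1 / 2 - τ / 2 - z) τ).mpr hτ
  simp only [← hterm] at hsum
  have htriple := jacobi_triple_product (Complex.exp_ne_zero _)
    (by rw [exp_pi_mul_I_sq]; exact norm_exp_two_pi_mul_I_lt_one hτ) (Complex.exp_ne_zero _) hsum
  rw [exp_pi_mul_I_sq, ← Complex.exp_sub,
    show 2 * π * I * τ - 2 * π * I * (-z) = 2 * π * I * (τ + z) by ring] at htriple
  have hrw : ∀ A B C D E : ℂ, A * B * C * (D * E) = A * (B * D * (C * E)) := by intros; ring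
  rw [hrw, ← htriple, jacobiTheta₁, ← (Equiv.neg ℤ).tsum_eq]
  congr 1
  rw [← tsum_mul_left]
  refine tsum_congr fun k => ?_
  have h : (-1 : ℂ) ^ (-k) = (-1) ^ k := by
    rcases Int.even_or_odd k with hk | hk <;> simp [hk.neg_one_zpow]
  simp only [Equiv.neg_apply, h, neg_one_zpow_eq_exp, ← Complex.exp_int_mul]
  simp only [← Complex.exp_add]
  congr 1
  push_cast
  ring

lemma jacobiTheta₁_neg (z τ : ℂ) : jacobiTheta₁ (-z) τ = -jacobiTheta₁ z τ := by
  have h (k : ℤ) : (-1 : ℂ) ^ (-1 - k) = -(-1) ^ k := by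
    rw [zpow_sub₀ (by norm_num), zpow_neg_one]
    rcases Int.even_or_odd k with hk | hk <;> simp [hk.neg_one_zpow]
  simp only [jacobiTheta₁]
  rw [← (Equiv.subLeft (-1 : ℤ)).tsum_eq, ← mul_neg, ← tsum_neg]
  congr 1
  refine tsum_congr fun k => ?_
  simp only [Equiv.subLeft_apply, h]
  push_cast
  ring_nf

lemma logDeriv_jacobiTheta₁_neg (z τ : ℂ) :
    logDeriv (jacobiTheta₁ · τ) (-z) = -logDeriv (jacobiTheta₁ · τ) z := by
  have h : (fun w => jacobiTheta₁ w τ) = fun w => -jacobiTheta₁ (-w) τ := by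
    funext w; rw [jacobiTheta₁_neg, neg_neg]
  rw [logDeriv_apply, logDeriv_apply, jacobiTheta₁_neg]
  have h2 : deriv (fun w => jacobiTheta₁ w τ) z = deriv (fun w => jacobiTheta₁ w τ) (-z) := by
    conv_lhs => rw [h]
    rw [deriv.fun_neg, deriv_comp_neg (fun w => jacobiTheta₁ w τ), neg_neg]
  rw [h2, div_neg]

lemma logDeriv_jacobiTheta₁_eq {z τ : ℂ} (hz : z.im < 0) (hzτ : -τ.im < z.im) :
    logDeriv (jacobiTheta₁ · τ) z = π * I +
      2 * π * I * (cexp (2 * π * I * (τ + z)) *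
        logDeriv (qPochhammer (cexp (2 * π * I * τ))) (cexp (2 * π * I * (τ + z)))) -
      2 * π * I * (cexp (2 * π * I * (-z)) *
        logDeriv (qPochhammer (cexp (2 * π * I * τ))) (cexp (2 * π * I * (-z)))) := by
  have hτ : 0 < τ.im := by linarith
  set q := cexp (2 * π * I * τ)
  have hq : ‖q‖ < 1 := norm_exp_two_pi_mul_I_lt_one hτ
  have h1 : ‖cexp (2 * π * I * (τ + z))‖ < 1 :=
    norm_exp_two_pi_mul_I_lt_one (by rw [add_im]; linarith)
  have h2 : ‖cexp (2 * π * I * (-z))‖ < 1 :=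
    norm_exp_two_pi_mul_I_lt_one (by rw [neg_im]; linarith)
  have d0 : HasDerivAt (fun w : ℂ => cexp (π * I * w)) (π * I * cexp (π * I * z)) z := by
    simpa [mul_comm] using ((hasDerivAt_id z).const_mul (π * I)).cexp
  have d1 : HasDerivAt (fun w : ℂ => cexp (2 * π * I * (τ + w)))
      (2 * π * I * cexp (2 * π * I * (τ + z))) z := by
    simpa [mul_comm] using (((hasDerivAt_id z).const_add τ).const_mul (2 * π * I)).cexp
  have d2 : HasDerivAt (fun w : ℂ => cexp (2 * π * I * (-w)))
      (-(2 * π * I * cexp (2 * π * I * (-z)))) z := by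
    simpa [mul_comm] using ((hasDerivAt_id z).neg.const_mul (2 * π * I)).cexp
  have e1 := (differentiableAt_qPochhammer hq h1).hasDerivAt.comp z d1
  have e2 := (differentiableAt_qPochhammer hq h2).hasDerivAt.comp z d2
  have n1 := qPochhammer_ne_zero hq h1
  have n2 := qPochhammer_ne_zero hq h2
  have hc : -I * cexp (π * I * τ / 4) * qPochhammer q q ≠ 0 :=
    mul_ne_zero (mul_ne_zero (neg_ne_zero.mpr I_ne_zero) (Complex.exp_ne_zero _))
      (qPochhammer_ne_zero hq hq)
  have hval := jacobiTheta₁_eq_qPochhammer hτ z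
  have hder : HasDerivAt (jacobiTheta₁ · τ) _ z :=
    ((d0.mul (e1.mul e2)).const_mul
      (-I * cexp (π * I * τ / 4) * qPochhammer q q)).congr_of_eventuallyEq
      (Eventually.of_forall fun w => jacobiTheta₁_eq_qPochhammer hτ w)
  rw [logDeriv_apply, hder.deriv, hval]
  simp only [logDeriv_apply, Function.comp, Pi.mul_apply]
  have h0 := Complex.exp_ne_zero (π * I * z)
  change _ / (-I * cexp (π * I * τ / 4) * qPochhammer q q * _) = _
  rw [mul_div_mul_left _ _ hc]
  generalize qPochhammer q (cexp (2 * π * I * (τ + z))) = P at *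
  generalize qPochhammer q (cexp (2 * π * I * (-z))) = R at *
  field_simp
  ring

lemma hasSum_int_zpow_div_one_sub_zpow {q y c A B : ℂ} (hq0 : q ≠ 0) (hq : ‖q‖ < 1) (hy : y ≠ 0)
    (hA : HasSum (fun n : ℕ => y ^ (n + 1) / (1 - q ^ (n + 1))) A)
    (hB : HasSum (fun n : ℕ => (q / y) ^ (n + 1) / (1 - q ^ (n + 1))) B) :
    HasSum (fun m : ℤ => if m = 0 then c else y ^ m / (1 - q ^ m)) (A + c - B) := by
  have key : HasSum (fun m : ℤ => if m = 0 then c else y ^ m / (1 - q ^ m))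
      (A + (if (0 : ℤ) = 0 then c else y ^ (0 : ℤ) / (1 - q ^ (0 : ℤ))) + -B) := by
    apply HasSum.of_add_one_of_neg_add_one
    · refine hA.congr_fun fun n => ?_
      rw [if_neg (by omega)]
      norm_cast
    · refine hB.neg.congr_fun fun n => ?_
      have hQ1 : 1 - q ^ (n + 1) ≠ 0 := by
        intro h
        have : ‖q ^ (n + 1)‖ < 1 := by
          rw [norm_pow]; exact pow_lt_one₀ (norm_nonneg _) hq (by omega)
        rw [← sub_eq_zero.mp h, norm_one] at this
        exact lt_irrefl _ this
      have hQ2 : q ^ (n + 1) - 1 ≠ 0 := fun h => hQ1 (by linear_combination -h)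
      have hQ : q ^ (n + 1) ≠ 0 := pow_ne_zero _ hq0
      have hY : y ^ (n + 1) ≠ 0 := pow_ne_zero _ hy
      rw [if_neg (by omega), zpow_neg, zpow_neg, div_pow]
      norm_cast
      generalize q ^ (n + 1) = Q at *
      generalize y ^ (n + 1) = Y at *
      have : 1 - Q⁻¹ = (Q - 1) / Q := by field_simp
      rw [this]
      field_simp
      ring
  simpa [sub_eq_add_neg] using key

/-- The Fourier expansion of the logarithmic derivative of `θ₁` in the strip `-Im τ < Im z < 0`. -/
lemma hasSum_logDeriv_jacobiTheta₁ {z τ : ℂ} (hz : z.im < 0) (hzτ : -τ.im < z.im) :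
    HasSum (fun m : ℤ => if m = 0 then π * I else
        2 * π * I * (cexp (2 * π * I * (-z)) ^ m / (1 - cexp (2 * π * I * τ) ^ m)))
      (logDeriv (jacobiTheta₁ · τ) z) := by
  have hτ : 0 < τ.im := by linarith
  set q := cexp (2 * π * I * τ)
  have hq : ‖q‖ < 1 := norm_exp_two_pi_mul_I_lt_one hτ
  have h1 : ‖cexp (2 * π * I * (τ + z))‖ < 1 :=
    norm_exp_two_pi_mul_I_lt_one (by rw [add_im]; linarith)
  have h2 : ‖cexp (2 * π * I * (-z))‖ < 1 :=
    norm_exp_two_pi_mul_I_lt_one (by rw [neg_im]; linarith)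
  have hsplit : cexp (2 * π * I * (τ + z)) = q / cexp (2 * π * I * (-z)) := by
    rw [← Complex.exp_sub]; congr 1; ring
  have s1 := hasSum_logDeriv_qPochhammer hq h1
  rw [hsplit] at s1
  have key := (hasSum_int_zpow_div_one_sub_zpow (c := 1 / 2) (Complex.exp_ne_zero _) hq
    (Complex.exp_ne_zero _) (hasSum_logDeriv_qPochhammer hq h2) s1).mul_left (2 * π * I)
  convert! key using 1
  · funext m
    split_ifs
    · ring
    · rfl
  · rw [logDeriv_jacobiTheta₁_eq hz hzτ, hsplit]
    ring

/-- The Fourier coefficients of `u ↦ (i/2π) (L(u + η) - L(u - η))`, where `L` is the logarithmic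
derivative of `θ₁(·;τ)`. -/
noncomputable def kernelCoeff (η τ : ℂ) (m : ℤ) : ℂ :=
  if m = 0 then 1 else
    cexp (2 * π * I * η) ^ m / (1 - cexp (2 * π * I * τ) ^ m) +
      cexp (2 * π * I * η) ^ (-m) / (1 - cexp (2 * π * I * τ) ^ (-m))

/-- The Fourier coefficients of `densityρ`. -/
noncomputable def densityCoeff (η : ℂ) (m : ℤ) : ℂ :=
  (2 * Complex.cosh (π * I * m * η))⁻¹

lemma hasSum_kernelCoeff {η τ : ℂ} (hη : 0 < η.im) (hητ : η.im < τ.im) (u : ℝ) :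
    HasSum (fun m : ℤ => kernelCoeff η τ m * cexp (2 * π * I * m * u))
      (I / (2 * π) * (logDeriv (jacobiTheta₁ · τ) (u + η) -
        logDeriv (jacobiTheta₁ · τ) (u - η))) := by
  have h1 := hasSum_logDeriv_jacobiTheta₁ (z := -(u + η)) (τ := τ) (by simpa) (by simpa)
  have h2 := hasSum_logDeriv_jacobiTheta₁ (z := u - η) (τ := τ) (by simpa) (by simpa)
  rw [← (Equiv.neg ℤ).hasSum_iff] at h2
  rw [logDeriv_jacobiTheta₁_neg] at h1
  have hπ : (π : ℂ) ≠ 0 := ofReal_ne_zero.mpr Real.pi_ne_zero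
  convert! (h1.add h2).mul_left (-I / (2 * π)) using 1
  · funext m
    simp only [Function.comp, Equiv.neg_apply, neg_eq_zero, kernelCoeff]
    split_ifs with hm
    · subst hm
      field_simp
      simp
      norm_num
    · have e1 : cexp (2 * π * I * (- -(u + η))) ^ m =
          cexp (2 * π * I * η) ^ m * cexp (2 * π * I * m * u) := by
        simp only [← Complex.exp_int_mul, ← Complex.exp_add]
        congr 1; ring
      have e2 : cexp (2 * π * I * (-(u - η))) ^ (-m) =
          cexp (2 * π * I * η) ^ (-m) * cexp (2 * π * I * m * u) := by
        simp only [← Complex.exp_int_mul, ← Complex.exp_add]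
        congr 1; push_cast; ring
      have e3 (A B : ℂ) : -I / (2 * π) * (2 * π * I * A + 2 * π * I * B) = A + B := by
        field_simp
        simp
      rw [e1, e2, e3]
      ring
  · ring

lemma summable_norm_kernelCoeff {η τ : ℂ} (hη : 0 < η.im) (hητ : η.im < τ.im) :
    Summable fun m => ‖kernelCoeff η τ m‖ := by
  simpa using (hasSum_kernelCoeff hη hητ 0).summable.norm

lemma exp_two_pi_mul_I_zpow_ne_one {w : ℂ} (hw : 0 < w.im) {m : ℤ} (hm : m ≠ 0) :
    cexp (2 * π * I * w) ^ m ≠ 1 := by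
  intro h
  rw [← Complex.exp_int_mul, Complex.exp_eq_one_iff] at h
  obtain ⟨n, hn⟩ := h
  have h2 : (m : ℂ) * w = n := by
    have := Complex.two_pi_I_ne_zero
    apply mul_left_cancel₀ this
    linear_combination hn
  have h3 := congrArg Complex.im h2
  simp [hm, hw.ne'] at h3

lemma one_add_kernelCoeff_mul_densityCoeff {η τ : ℂ} (hη : 0 < η.im) (hτ : 0 < τ.im) (m : ℤ) :
    (1 + kernelCoeff η τ m) * densityCoeff η m = kernelCoeff (η / 2) τ m := by
  rcases eq_or_ne m 0 with rfl | hm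
  · simp [kernelCoeff, densityCoeff]; norm_num
  have hB : cexp (2 * π * I * (η / 2)) ^ m ≠ 0 := zpow_ne_zero _ (Complex.exp_ne_zero _)
  have hA : cexp (2 * π * I * η) ^ m = (cexp (2 * π * I * (η / 2)) ^ m) ^ 2 := by
    simp only [← Complex.exp_int_mul, ← Complex.exp_nat_mul]
    congr 1; push_cast; ring
  have hcosh : 2 * Complex.cosh (π * I * m * η) =
      cexp (2 * π * I * (η / 2)) ^ m + (cexp (2 * π * I * (η / 2)) ^ m)⁻¹ := by
    rw [Complex.two_cosh, ← zpow_neg]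
    simp only [← Complex.exp_int_mul]
    congr 2 <;> (push_cast; ring)
  have hA1 : (cexp (2 * π * I * (η / 2)) ^ m) ^ 2 + 1 ≠ 0 := by
    intro h
    have h4 := exp_two_pi_mul_I_zpow_ne_one hη (m := m * 2) (by omega)
    rw [zpow_mul, hA] at h4
    apply h4
    rw [eq_neg_of_add_eq_zero_left h]
    norm_num
  have hT := exp_two_pi_mul_I_zpow_ne_one hτ hm
  have hT0 : cexp (2 * π * I * τ) ^ m ≠ 0 := zpow_ne_zero _ (Complex.exp_ne_zero _)
  simp only [kernelCoeff, densityCoeff, if_neg hm, zpow_neg, hcosh, hA]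
  generalize cexp (2 * π * I * (η / 2)) ^ m = B at *
  generalize cexp (2 * π * I * τ) ^ m = T at *
  have hT1 : 1 - T ≠ 0 := sub_ne_zero.mpr hT.symm
  have hT2 : T - 1 ≠ 0 := sub_ne_zero.mpr hT
  have e1 : 1 - T⁻¹ = -(1 - T) / T := by field_simp; ring
  have e2 : B + B⁻¹ = (B ^ 2 + 1) / B := by field_simp
  rw [e1, e2]
  field_simp
  ring

lemma summable_norm_densityCoeff {η τ : ℂ} (hη : 0 < η.im) (hητ : η.im < τ.im) :
    Summable fun m => ‖densityCoeff η m‖ := by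
  have hs := summable_norm_kernelCoeff (η := η / 2) (τ := τ) (by simpa) (by simp; linarith)
  refine Summable.of_norm_bounded_eventually (hs.mul_left 2) ?_
  have ht := (summable_norm_kernelCoeff hη hητ).tendsto_cofinite_zero
  filter_upwards [ht.eventually_lt_const (show (0 : ℝ) < 1 / 2 by norm_num)] with m hm
  rw [norm_norm, ← one_add_kernelCoeff_mul_densityCoeff hη (hη.trans hητ), norm_mul]
  have h1 : 1 / 2 ≤ ‖1 + kernelCoeff η τ m‖ := by
    have := norm_sub_le (1 + kernelCoeff η τ m) (kernelCoeff η τ m)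
    rw [add_sub_cancel_right, norm_one] at this
    linarith
  nlinarith [norm_nonneg (densityCoeff η m)]

lemma integral_exp_two_pi_mul_I (k : ℤ) :
    ∫ w in (-(1 / 2) : ℝ)..(1 / 2 : ℝ), cexp (2 * π * I * k * w) = if k = 0 then 1 else 0 := by
  split_ifs with hk
  · subst hk
    simp
    norm_num
  · have hc : 2 * π * I * k ≠ 0 := mul_ne_zero Complex.two_pi_I_ne_zero (Int.cast_ne_zero.mpr hk)
    rw [integral_exp_mul_complex hc, div_eq_zero_iff, sub_eq_zero]
    left
    rw [Complex.exp_eq_exp_iff_exists_int]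
    exact ⟨k, by push_cast; ring⟩

lemma norm_exp_two_pi_mul_I_int_mul (k : ℤ) (w : ℝ) : ‖cexp (2 * π * I * k * w)‖ = 1 := by
  rw [show 2 * π * I * k * w = ((2 * π * k * w : ℝ) : ℂ) * I by push_cast; ring,
    Complex.norm_exp_ofReal_mul_I]

lemma hasSum_intervalIntegral_mul_of_summable_norm {F : ℤ → ℝ → ℂ} {g : ℝ → ℂ} {a b B : ℝ}
    {u : ℤ → ℝ} (hF : ∀ n, Continuous (F n)) (hg : Continuous g) (hu : Summable u)
    (hFu : ∀ n w, ‖F n w‖ ≤ u n) (hgB : ∀ w, ‖g w‖ ≤ B) :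
    HasSum (fun n => ∫ w in a..b, F n w * g w) (∫ w in a..b, (∑' n, F n w) * g w) := by
  refine intervalIntegral.hasSum_integral_of_dominated_convergence (fun n _ => u n * B)
    (fun n => ((hF n).mul hg).aestronglyMeasurable) ?_ ?_ ?_ ?_
  · refine fun n => ae_of_all _ fun w _ => ?_
    rw [norm_mul]
    exact mul_le_mul (hFu n w) (hgB w) (norm_nonneg _) ((norm_nonneg _).trans (hFu n w))
  · exact ae_of_all _ fun _ _ => hu.mul_right B
  · exact intervalIntegrable_const
  · exact ae_of_all _ fun w _ =>
      (Summable.of_norm_bounded hu fun n => hFu n w).hasSum.mul_right _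

lemma integral_fourierSeries_mul_exp {b : ℤ → ℂ} (hb : Summable fun m => ‖b m‖) (n : ℤ) (z : ℝ) :
    ∫ w in (-(1 / 2) : ℝ)..(1 / 2 : ℝ), (∑' m : ℤ, b m * cexp (2 * π * I * m * w)) *
        cexp (2 * π * I * n * (z - w)) = b n * cexp (2 * π * I * n * z) := by
  have hterm (m : ℤ) (w : ℝ) : b m * cexp (2 * π * I * m * w) * cexp (2 * π * I * n * (z - w)) =
      b m * cexp (2 * π * I * n * z) * cexp (2 * π * I * (m - n : ℤ) * w) := by
    rw [mul_assoc (b m), ← Complex.exp_add, mul_assoc (b m), ← Complex.exp_add]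
    congr 2
    push_cast
    ring
  have key := hasSum_intervalIntegral_mul_of_summable_norm (a := -(1 / 2)) (b := 1 / 2) (B := 1)
    (F := fun (m : ℤ) (w : ℝ) => b m * cexp (2 * π * I * m * w))
    (g := fun w : ℝ => cexp (2 * π * I * n * (z - w)))
    (fun m => by fun_prop) (by fun_prop) hb
    (fun m w => by rw [norm_mul, norm_exp_two_pi_mul_I_int_mul, mul_one])
    (fun w => by rw [← ofReal_sub, norm_exp_two_pi_mul_I_int_mul])
  refine key.unique ?_
  simp only [hterm, intervalIntegral.integral_const_mul, integral_exp_two_pi_mul_I]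
  convert! hasSum_ite_eq n (b n * cexp (2 * π * I * n * z)) using 1
  funext m
  by_cases h : m = n
  · simp [h]
  · simp [h, sub_eq_zero]

/-- Convolution of absolutely convergent Fourier series. -/
lemma hasSum_convolution_fourierSeries {a b : ℤ → ℂ} (ha : Summable fun m => ‖a m‖)
    (hb : Summable fun m => ‖b m‖) (z : ℝ) :
    HasSum (fun n : ℤ => a n * b n * cexp (2 * π * I * n * z))
      (∫ w in (-(1 / 2) : ℝ)..(1 / 2 : ℝ), (∑' n : ℤ, a n * cexp (2 * π * I * n * (z - w))) *
        ∑' m : ℤ, b m * cexp (2 * π * I * m * w)) := by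
  have hcont : Continuous fun w : ℝ => ∑' m : ℤ, b m * cexp (2 * π * I * m * w) :=
    continuous_tsum (fun m => by fun_prop) hb fun m w => by
      rw [norm_mul, norm_exp_two_pi_mul_I_int_mul, mul_one]
  have hbound (w : ℝ) : ‖∑' m : ℤ, b m * cexp (2 * π * I * m * w)‖ ≤ ∑' m, ‖b m‖ :=
    tsum_of_norm_bounded hb.hasSum fun m => by
      rw [norm_mul, norm_exp_two_pi_mul_I_int_mul, mul_one]
  have key := hasSum_intervalIntegral_mul_of_summable_norm (a := -(1 / 2)) (b := 1 / 2)
    (F := fun (n : ℤ) (w : ℝ) => a n * cexp (2 * π * I * n * (z - w)))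
    (fun n => by fun_prop) hcont ha
    (fun n w => by rw [← ofReal_sub, norm_mul, norm_exp_two_pi_mul_I_int_mul, mul_one]) hbound
  convert! key using 1
  funext n
  rw [mul_assoc, ← integral_fourierSeries_mul_exp hb, ← intervalIntegral.integral_const_mul]
  congr 1
  funext w
  ring

lemma densityρ_eq_tsum (η : ℂ) (z : ℝ) :
    densityρ η z = ∑' m : ℤ, densityCoeff η m * cexp (2 * π * I * m * z) :=
  tsum_congr fun _ => by rw [densityCoeff, div_eq_inv_mul]

lemma jacobiTheta₁'_div_jacobiTheta₁ (z τ : ℂ) :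
    jacobiTheta₁' z τ / jacobiTheta₁ z τ = logDeriv (jacobiTheta₁ · τ) z := rfl

end

/-- The density `ρ` solves the Lieb integral equation
`ρ(z) + ∫_{-1/2}^{1/2} K(z-w) ρ(w) dw = p₀'(z)/(2π)`. -/
theorem density_solves_lieb_equation (ηt τt : ℂ)
    (hη : 0 < ηt.im) (hητ : 2 * ηt.im < τt.im) (z : ℝ) :
    densityρ ηt z +
        (∫ w in (-(1 / 2) : ℝ)..(1 / 2 : ℝ),
          (Complex.I / (2 * (π : ℂ))) *
              (jacobiTheta₁' ((z : ℂ) - (w : ℂ) + ηt) τt /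
                  jacobiTheta₁ ((z : ℂ) - (w : ℂ) + ηt) τt -
                jacobiTheta₁' ((z : ℂ) - (w : ℂ) - ηt) τt /
                  jacobiTheta₁ ((z : ℂ) - (w : ℂ) - ηt) τt) *
            densityρ ηt w)
      = (Complex.I *
          (jacobiTheta₁' ((z : ℂ) + ηt / 2) τt / jacobiTheta₁ ((z : ℂ) + ηt / 2) τt -
            jacobiTheta₁' ((z : ℂ) - ηt / 2) τt / jacobiTheta₁ ((z : ℂ) - ηt / 2) τt)) /
          (2 * (π : ℂ)) := by
  have hτ : 0 < τt.im := by linarith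
  have hlt : ηt.im < τt.im := by linarith
  have ha := summable_norm_kernelCoeff hη hlt
  have hb := summable_norm_densityCoeff hη hlt
  have hK (w : ℝ) := (hasSum_kernelCoeff hη hlt (z - w)).tsum_eq
  push_cast at hK
  have hp := hasSum_kernelCoeff (η := ηt / 2) (τ := τt) (by simpa) (by simp; linarith) z
  have hρ : HasSum (fun m : ℤ => densityCoeff ηt m * cexp (2 * π * I * m * z)) (densityρ ηt z) := by
    rw [densityρ_eq_tsum]
    exact (Summable.of_norm (by
      simpa only [norm_mul, norm_exp_two_pi_mul_I_int_mul, mul_one] using hb)).hasSum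
  have hconv := hasSum_convolution_fourierSeries ha hb z
  simp only [hK, ← densityρ_eq_tsum] at hconv
  simp only [jacobiTheta₁'_div_jacobiTheta₁]
  refine (hρ.add hconv).unique ?_
  convert! hp using 1
  · funext m
    rw [← one_add_kernelCoeff_mul_densityCoeff hη hτ]
    ring
  · ring
end

section
/- The density ρ(z) = ∑_{m∈ℤ} e^{2πimz}/(2cosh(iπmη̃)) admits the closed form ρ(z) = (1/2π) · θ₁'(0;η̃)θ₃(z;η̃)/(θ₂(0;η̃)θ₄(z;η̃)). -/
open Complex Real BigOperators

/-- `θ₄(z;τ) = -i e^{iπτ/4} e^{iπz} θ₁(z+τ/2;τ)`. -/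
noncomputable def jTheta₄ (z τ : ℂ) : ℂ :=
  -Complex.I * Complex.exp ((π : ℂ) * Complex.I * τ / 4) *
    Complex.exp ((π : ℂ) * Complex.I * z) * jacobiTheta₁ (z + τ / 2) τ

/-- `θ₃(z;τ) = θ₄(z+1/2;τ)`. -/
noncomputable def jTheta₃ (z τ : ℂ) : ℂ := jTheta₄ (z + 1 / 2) τ

open Filter Topology

/-- The product of the terms indexed by `m + l` and `m - l` of two theta series. -/
lemma jacobiTheta₂_term_mul_even (m l : ℤ) (x y τ : ℂ) :
    jacobiTheta₂_term (m + l) x τ * jacobiTheta₂_term (m - l) y τ =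
      jacobiTheta₂_term m (x + y) (2 * τ) * jacobiTheta₂_term l (x - y) (2 * τ) := by
  simp only [jacobiTheta₂_term, ← Complex.exp_add]
  congr 1
  push_cast
  ring

/-- The product of the terms indexed by `m + l + 1` and `m - l` of two theta series. -/
lemma jacobiTheta₂_term_mul_odd (m l : ℤ) (x y τ : ℂ) :
    jacobiTheta₂_term (m + l + 1) x τ * jacobiTheta₂_term (m - l) y τ =
      cexp (2 * π * I * x + π * I * τ) *
        (jacobiTheta₂_term m (x + y + τ) (2 * τ) *
          jacobiTheta₂_term l (x - y + τ) (2 * τ)) := by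
  simp only [jacobiTheta₂_term, ← Complex.exp_add]
  congr 1
  push_cast
  ring

/-- Products of terms of two theta series are summable over pairs of integers. -/
lemma summable_jacobiTheta₂_term_mul (x y : ℂ) {τ : ℂ} (hτ : 0 < τ.im) :
    Summable fun p : ℤ × ℤ ↦ jacobiTheta₂_term p.1 x τ * jacobiTheta₂_term p.2 y τ :=
  summable_mul_of_summable_norm (f := fun n ↦ jacobiTheta₂_term n x τ)
    (g := fun n ↦ jacobiTheta₂_term n y τ) ((summable_jacobiTheta₂_term_iff x τ).2 hτ).norm
    ((summable_jacobiTheta₂_term_iff y τ).2 hτ).norm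

/-- A product of two theta values is a sum over pairs of integers. -/
lemma jacobiTheta₂_mul_eq_tsum (x y : ℂ) {τ : ℂ} (hτ : 0 < τ.im) :
    jacobiTheta₂ x τ * jacobiTheta₂ y τ =
      ∑' p : ℤ × ℤ, jacobiTheta₂_term p.1 x τ * jacobiTheta₂_term p.2 y τ :=
  tsum_mul_tsum_of_summable_norm ((summable_jacobiTheta₂_term_iff x τ).2 hτ).norm
    ((summable_jacobiTheta₂_term_iff y τ).2 hτ).norm

/-- The addition formula for theta functions with doubled quasi-period. -/
lemma jacobiTheta₂_mul (x y : ℂ) {τ : ℂ} (hτ : 0 < τ.im) :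
    jacobiTheta₂ x τ * jacobiTheta₂ y τ =
      jacobiTheta₂ (x + y) (2 * τ) * jacobiTheta₂ (x - y) (2 * τ) +
        cexp (2 * π * I * x + π * I * τ) *
          (jacobiTheta₂ (x + y + τ) (2 * τ) * jacobiTheta₂ (x - y + τ) (2 * τ)) := by
  have h2 : 0 < (2 * τ).im := by simpa using hτ
  let e : (ℤ × ℤ) ⊕ (ℤ × ℤ) → ℤ × ℤ :=
    Sum.elim (fun p ↦ (p.1 + p.2, p.1 - p.2)) (fun p ↦ (p.1 + p.2 + 1, p.1 - p.2))
  have he : Function.Bijective e := by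
    constructor
    · rintro (⟨a, b⟩ | ⟨a, b⟩) (⟨c, d⟩ | ⟨c, d⟩) h <;> simp [e] at h ⊢ <;> omega
    · rintro ⟨a, b⟩
      rcases Int.even_or_odd' (a + b) with ⟨k, hk | hk⟩
      · exact ⟨Sum.inl (k, k - b), by simp [e]; omega⟩
      · exact ⟨Sum.inr (k, k - b), by simp [e]; omega⟩
  rw [jacobiTheta₂_mul_eq_tsum x y hτ, jacobiTheta₂_mul_eq_tsum _ _ h2,
    jacobiTheta₂_mul_eq_tsum _ _ h2, ← tsum_mul_left, ← (Equiv.ofBijective e he).tsum_eq,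
    Summable.tsum_sum]
  · simp [e, jacobiTheta₂_term_mul_even, jacobiTheta₂_term_mul_odd]
  · simpa [Function.comp_def, e, jacobiTheta₂_term_mul_even] using
      summable_jacobiTheta₂_term_mul (x + y) (x - y) h2
  · simpa [Function.comp_def, e, jacobiTheta₂_term_mul_odd] using
      (summable_jacobiTheta₂_term_mul (x + y + τ) (x - y + τ) h2).mul_left
        (cexp (2 * π * I * x + π * I * τ))

/-- The theta function vanishes at `1 / 2 + τ / 2`. -/
lemma jacobiTheta₂_half_add_half (τ : ℂ) : jacobiTheta₂ (1 / 2 + τ / 2) τ = 0 := by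
  have h1 := jacobiTheta₂_add_left' (-(1 / 2 + τ / 2)) τ
  rw [← jacobiTheta₂_add_left, jacobiTheta₂_neg_left,
    show -(1 / 2 + τ / 2) + τ + 1 = 1 / 2 + τ / 2 by ring,
    show -π * I * (τ + 2 * -(1 / 2 + τ / 2)) = π * I by ring, Complex.exp_pi_mul_I] at h1
  linear_combination h1 / 2

/-- The theta function vanishes at all translates of `1 / 2 + τ / 2` by multiples of `τ`. -/
lemma jacobiTheta₂_half_add_half_add_int_mul (τ : ℂ) (k : ℤ) :
    jacobiTheta₂ (1 / 2 + τ / 2 + k * τ) τ = 0 := by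
  induction k using Int.induction_on with
  | zero => simpa using jacobiTheta₂_half_add_half τ
  | succ k ih =>
    have := jacobiTheta₂_add_left' (1 / 2 + τ / 2 + (k : ℤ) * τ) τ
    rw [ih, mul_zero] at this
    rw [← this]
    push_cast
    ring_nf
  | pred k ih =>
    have := jacobiTheta₂_add_left' (1 / 2 + τ / 2 + (-k - 1 : ℤ) * τ) τ
    rw [show 1 / 2 + τ / 2 + ((-k - 1 : ℤ) : ℂ) * τ + τ = 1 / 2 + τ / 2 + ((-k : ℤ) : ℂ) * τ by
      push_cast; ring, ih] at this
    exact (mul_eq_zero.1 this.symm).resolve_left (Complex.exp_ne_zero _)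

/-- The Landen transformation of theta functions. -/
lemma jacobiTheta₂_mul_add_half (z : ℂ) {τ : ℂ} (hτ : 0 < τ.im) :
    jacobiTheta₂ (z + 1 / 2) τ * jacobiTheta₂ z τ =
      jacobiTheta₂ (2 * z + 1 / 2) (2 * τ) * jacobiTheta₂ (1 / 2) (2 * τ) := by
  have h0 : jacobiTheta₂ (z + 1 / 2 - z + τ) (2 * τ) = 0 := by
    rw [← jacobiTheta₂_half_add_half (2 * τ)]
    ring_nf
  rw [jacobiTheta₂_mul _ _ hτ, h0]
  ring_nf

/-- Theta values at real points tend to `1` along doublings of the quasi-period. -/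
lemma tendsto_jacobiTheta₂_two_pow (x : ℕ → ℝ) {τ : ℂ} (hτ : 0 < τ.im) :
    Tendsto (fun k ↦ jacobiTheta₂ (x k) (2 ^ k * τ)) atTop (𝓝 1) := by
  have him (k : ℕ) : ((2 : ℂ) ^ k * τ).im = 2 ^ k * τ.im := by
    rw [show (2 : ℂ) ^ k = ((2 ^ k : ℝ) : ℂ) by push_cast; rfl, im_ofReal_mul]
  have hs : Summable fun n : ℤ ↦ rexp (-π * (τ.im * n ^ 2 - 2 * 0 * |n|)) := by
    simpa using summable_pow_mul_jacobiTheta₂_term_bound 0 hτ 0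
  have h1 : ∑' n : ℤ, (if n = 0 then (1 : ℂ) else 0) = 1 := by simp
  rw [← h1]
  refine tendsto_tsum_of_dominated_convergence hs (fun n ↦ ?_) (Eventually.of_forall fun k n ↦ ?_)
  · split_ifs with hn
    · simp [hn, jacobiTheta₂_term]
    · rw [tendsto_zero_iff_norm_tendsto_zero]
      simp only [norm_jacobiTheta₂_term, him, ofReal_im, mul_zero, sub_zero]
      refine Real.tendsto_exp_atBot.comp ?_
      have hn' : (0 : ℝ) < π * n ^ 2 * τ.im := by positivity
      have := ((tendsto_pow_atTop_atTop_of_one_lt (one_lt_two (α := ℝ))).const_mul_atTop hn')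
      refine (tendsto_neg_atTop_atBot.comp this).congr fun k ↦ ?_
      simp only [Function.comp]
      ring
  · refine norm_jacobiTheta₂_term_le hτ (by simp) ?_ n
    rw [him]
    exact le_mul_of_one_le_left hτ.le (one_le_pow₀ one_le_two)

/-- The theta function has no real zeros. -/
lemma jacobiTheta₂_ofReal_ne_zero (x : ℝ) {τ : ℂ} (hτ : 0 < τ.im) :
    jacobiTheta₂ x τ ≠ 0 := by
  intro hx
  have key (k : ℕ) : 0 < ((2 : ℂ) ^ k * τ).im ∧ ∃ y : ℝ, jacobiTheta₂ y (2 ^ k * τ) = 0 := by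
    induction k with
    | zero => exact ⟨by simpa using hτ, x, by simpa using hx⟩
    | succ k ih =>
      obtain ⟨him, y, hy⟩ := ih
      have hd : (2 : ℂ) ^ (k + 1) * τ = 2 * (2 ^ k * τ) := by ring
      refine ⟨by rw [hd]; simpa using him, ?_⟩
      have := jacobiTheta₂_mul_add_half y him
      rw [hy, mul_zero, eq_comm, mul_eq_zero, ← hd] at this
      rcases this with h | h
      · exact ⟨2 * y + 1 / 2, by push_cast; exact h⟩
      · exact ⟨1 / 2, by push_cast; exact h⟩
  choose _ y hy using key
  have := tendsto_jacobiTheta₂_two_pow y hτ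
  simp only [hy] at this
  exact zero_ne_one (tendsto_nhds_unique tendsto_const_nhds this)

/-- The theta function does not vanish at `τ / 2`. -/
lemma jacobiTheta₂_half_period_ne_zero {τ : ℂ} (hτ : 0 < τ.im) :
    jacobiTheta₂ (τ / 2) τ ≠ 0 := by
  have h0 : τ ≠ 0 := by rintro rfl; simp at hτ
  have him : 0 < (-1 / τ).im := by
    rw [neg_div, neg_im, one_div, inv_im, neg_div, neg_neg]
    exact div_pos hτ (normSq_pos.2 h0)
  rw [jacobiTheta₂_functional_equation]
  have : τ / 2 / τ = ((1 / 2 : ℝ) : ℂ) := by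
    push_cast
    field_simp
  rw [this]
  refine mul_ne_zero (mul_ne_zero (one_div_ne_zero ?_) (Complex.exp_ne_zero _))
    (jacobiTheta₂_ofReal_ne_zero _ him)
  rw [Complex.cpow_ne_zero_iff]
  exact Or.inl (by simp [h0])

/-- The Fourier coefficients `1 / (2 cosh (iπmτ))`. -/
noncomputable def sechCoeff (τ : ℂ) (m : ℤ) : ℂ := 1 / (2 * Complex.cosh (π * I * m * τ))

lemma sechCoeff_neg (τ : ℂ) (m : ℤ) : sechCoeff τ (-m) = sechCoeff τ m := by
  rw [sechCoeff, sechCoeff, ← Complex.cosh_neg]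
  push_cast
  ring_nf

lemma norm_exp_pi_mul_I_mul (τ : ℂ) (m : ℤ) :
    ‖cexp (π * I * m * τ)‖ = rexp (-π * τ.im * m) := by
  rw [Complex.norm_exp, show (π * I * m * τ : ℂ) = ((π * m : ℝ) : ℂ) * (τ * I) by push_cast; ring,
    re_ofReal_mul, mul_I_re]
  ring_nf

lemma one_sub_le_norm_exp_mul_cosh {τ : ℂ} (hτ : 0 < τ.im) {m : ℤ} (hm : 0 ≤ m) :
    1 - rexp (-π * τ.im) ≤ ‖cexp (π * I * m * τ) * (2 * Complex.cosh (π * I * m * τ))‖ := by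
  have h1 : cexp (π * I * m * τ) * (2 * Complex.cosh (π * I * m * τ)) =
      1 + cexp (π * I * (2 * m : ℤ) * τ) := by
    rw [Complex.two_cosh, mul_add, ← Complex.exp_add, ← Complex.exp_add, add_neg_cancel,
      Complex.exp_zero]
    push_cast
    ring_nf
  rw [h1]
  rcases hm.eq_or_lt with rfl | hm
  · norm_num
    have := Real.exp_pos (-(π * τ.im))
    linarith
  · have h2 : rexp (-π * τ.im * (2 * m : ℤ)) ≤ rexp (-π * τ.im) := by
      rw [Real.exp_le_exp]
      have h3 : (1 : ℝ) ≤ (2 * m : ℤ) := by exact_mod_cast (by omega : 1 ≤ 2 * m)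
      have h4 : 0 < π * τ.im := mul_pos Real.pi_pos hτ
      nlinarith
    rw [← norm_exp_pi_mul_I_mul] at h2
    have := norm_sub_le_norm_add (1 : ℂ) (cexp (π * I * (2 * m : ℤ) * τ))
    rw [norm_one] at this
    linarith

lemma one_sub_exp_pos {τ : ℂ} (hτ : 0 < τ.im) : 0 < 1 - rexp (-π * τ.im) := by
  rw [sub_pos, Real.exp_lt_one_iff, neg_mul, neg_lt_zero]
  exact mul_pos Real.pi_pos hτ

lemma two_mul_cosh_ne_zero {τ : ℂ} (hτ : 0 < τ.im) (m : ℤ) :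
    2 * Complex.cosh (π * I * m * τ) ≠ 0 := by
  have h0 (m : ℤ) (hm : 0 ≤ m) : 2 * Complex.cosh (π * I * m * τ) ≠ 0 := by
    intro h
    have := one_sub_le_norm_exp_mul_cosh hτ hm
    rw [h, mul_zero, norm_zero] at this
    exact this.not_gt (one_sub_exp_pos hτ)
  rcases le_total 0 m with hm | hm
  · exact h0 m hm
  · have := h0 (-m) (by omega)
    rwa [← Complex.cosh_neg, show -(π * I * (-m : ℤ) * τ) = π * I * m * τ by
      push_cast; ring] at this

lemma two_mul_cosh_mul_sechCoeff {τ : ℂ} (hτ : 0 < τ.im) (m : ℤ) :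
    2 * Complex.cosh (π * I * m * τ) * sechCoeff τ m = 1 :=
  mul_one_div_cancel (two_mul_cosh_ne_zero hτ m)

lemma norm_sechCoeff_le_of_nonneg {τ : ℂ} (hτ : 0 < τ.im) {m : ℤ} (hm : 0 ≤ m) :
    ‖sechCoeff τ m‖ ≤ (1 - rexp (-π * τ.im))⁻¹ * rexp (-π * τ.im * m) := by
  have h1 := one_sub_le_norm_exp_mul_cosh hτ hm
  have h2 := congrArg norm (two_mul_cosh_mul_sechCoeff hτ m)
  rw [norm_mul, norm_one] at h2
  rw [norm_mul, norm_exp_pi_mul_I_mul] at h1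
  rw [inv_mul_eq_div, le_div_iff₀ (one_sub_exp_pos hτ)]
  calc _ ≤ ‖sechCoeff τ m‖ *
      (rexp (-π * τ.im * m) * ‖2 * Complex.cosh (π * I * m * τ)‖) := by gcongr
    _ = rexp (-π * τ.im * m) := by linear_combination rexp (-π * τ.im * m) * h2

lemma norm_sechCoeff_le {τ : ℂ} (hτ : 0 < τ.im) (m : ℤ) :
    ‖sechCoeff τ m‖ ≤ (1 - rexp (-π * τ.im))⁻¹ * rexp (-π * τ.im * |(m : ℝ)|) := by
  have := norm_sechCoeff_le_of_nonneg hτ (abs_nonneg m)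
  rcases abs_choice m with h | h
  · rw [h] at this
    rw [← Int.cast_abs, h]
    exact this
  · rw [h, sechCoeff_neg] at this
    rw [← Int.cast_abs, h]
    exact this

lemma summable_exp_neg_mul_abs {a : ℝ} (ha : 0 < a) :
    Summable fun m : ℤ ↦ rexp (-a * |(m : ℝ)|) := by
  have h : Summable fun n : ℕ ↦ rexp (-a * n) := by
    have := Real.summable_exp_nat_mul_iff.2 (neg_lt_zero.2 ha)
    simpa only [mul_comm] using this
  apply Summable.of_nat_of_neg <;> simpa using h

lemma norm_sechCoeff_le_const {τ : ℂ} (hτ : 0 < τ.im) (m : ℤ) :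
    ‖sechCoeff τ m‖ ≤ (1 - rexp (-π * τ.im))⁻¹ := by
  refine (norm_sechCoeff_le hτ m).trans
    (mul_le_of_le_one_right (inv_pos.2 (one_sub_exp_pos hτ)).le (Real.exp_le_one_iff.2 ?_))
  have h4 : 0 < π * τ.im := mul_pos Real.pi_pos hτ
  have := mul_nonneg h4.le (abs_nonneg (m : ℝ))
  linarith

/-- The Fourier series with coefficients `sechCoeff` converges absolutely on the real line. -/
lemma summable_norm_exp_mul_sechCoeff {τ : ℂ} (hτ : 0 < τ.im) (z : ℝ) :
    Summable fun m : ℤ ↦ ‖cexp (2 * π * I * m * z) * sechCoeff τ m‖ := by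
  have h := (summable_exp_neg_mul_abs (mul_pos Real.pi_pos hτ)).mul_left
    (1 - rexp (-π * τ.im))⁻¹
  refine h.of_nonneg_of_le (fun _ ↦ norm_nonneg _) fun m ↦ ?_
  rw [norm_mul, show (2 * π * I * m * z : ℂ) = ((2 * π * m * z : ℝ) : ℂ) * I by push_cast; ring,
    Complex.norm_exp_ofReal_mul_I, one_mul, ← neg_mul]
  exact norm_sechCoeff_le hτ m

/-- Theta series weighted by the coefficients `sechCoeff`. -/
noncomputable def sechTheta (z τ : ℂ) : ℂ :=
  ∑' m : ℤ, jacobiTheta₂_term m z τ * sechCoeff τ m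

lemma hasSum_sechTheta (z : ℂ) {τ : ℂ} (hτ : 0 < τ.im) :
    HasSum (fun m : ℤ ↦ jacobiTheta₂_term m z τ * sechCoeff τ m) (sechTheta z τ) := by
  refine Summable.hasSum (Summable.of_norm ?_)
  refine ((((summable_jacobiTheta₂_term_iff z τ).2 hτ).norm).mul_right
    (1 - rexp (-π * τ.im))⁻¹).of_nonneg_of_le (fun _ ↦ norm_nonneg _) fun m ↦ ?_
  rw [norm_mul]
  gcongr
  exact norm_sechCoeff_le_const hτ m

/-- Adding two shifts of `sechTheta` cancels the coefficients. -/
lemma sechTheta_add_sechTheta (z : ℂ) {τ : ℂ} (hτ : 0 < τ.im) :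
    sechTheta (z - τ / 2) τ + sechTheta (z + τ / 2) τ = jacobiTheta₂ z τ := by
  rw [← ((hasSum_sechTheta (z - τ / 2) hτ).add (hasSum_sechTheta (z + τ / 2) hτ)).tsum_eq]
  refine tsum_congr fun m ↦ ?_
  have h1 : jacobiTheta₂_term m (z - τ / 2) τ =
      jacobiTheta₂_term m z τ * cexp (-(π * I * m * τ)) := by
    rw [jacobiTheta₂_term, jacobiTheta₂_term, ← Complex.exp_add]
    ring_nf
  have h2 : jacobiTheta₂_term m (z + τ / 2) τ =
      jacobiTheta₂_term m z τ * cexp (π * I * m * τ) := by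
    rw [jacobiTheta₂_term, jacobiTheta₂_term, ← Complex.exp_add]
    ring_nf
  have h3 := two_mul_cosh_mul_sechCoeff hτ m
  rw [Complex.two_cosh] at h3
  rw [h1, h2]
  linear_combination jacobiTheta₂_term m z τ * h3

lemma sechTheta_sub_int_mul (N : ℤ) {τ : ℂ} (hτ : 0 < τ.im) :
    sechTheta (-(1 / 2) - N * τ) τ = (-1) ^ N * sechTheta (-(1 / 2)) τ := by
  have h (N : ℤ) : sechTheta (-(1 / 2) - (N + 1 : ℤ) * τ) τ =
      -sechTheta (-(1 / 2) - N * τ) τ := by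
    have h1 := sechTheta_add_sechTheta (-(1 / 2 + τ / 2 + N * τ)) hτ
    rw [jacobiTheta₂_neg_left, jacobiTheta₂_half_add_half_add_int_mul] at h1
    rw [← add_eq_zero_iff_eq_neg, ← h1]
    push_cast
    ring_nf
  induction N using Int.induction_on with
  | zero => simp
  | succ k ih => rw [h, ih, zpow_add_one₀ (by norm_num)]; ring
  | pred k ih =>
    have := h (-k - 1)
    rw [sub_add_cancel, ih] at this
    rw [zpow_sub_one₀ (by norm_num)]
    linear_combination this

lemma jacobiTheta₂_term_add_half (N : ℤ) (z τ : ℂ) :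
    jacobiTheta₂_term N (z + 1 / 2) τ = (-1) ^ N * jacobiTheta₂_term N z τ := by
  rw [jacobiTheta₂_term, jacobiTheta₂_term, ← Complex.exp_pi_mul_I, ← Complex.exp_int_mul,
    ← Complex.exp_add]
  ring_nf

/-- The convolution of the coefficients of the two series is again a theta series. -/
lemma hasSum_exp_mul_sechCoeff_mul (N : ℤ) (z : ℂ) {τ : ℂ} (hτ : 0 < τ.im) :
    HasSum (fun m : ℤ ↦ cexp (2 * π * I * m * z) * sechCoeff τ m *
        jacobiTheta₂_term (N - m) (z + 1 / 2) τ)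
      (jacobiTheta₂_term N z τ * sechTheta (-(1 / 2)) τ) := by
  have h := (hasSum_sechTheta (-(1 / 2) - N * τ) hτ).mul_left
    (jacobiTheta₂_term N (z + 1 / 2) τ)
  have h1 : jacobiTheta₂_term N (z + 1 / 2) τ * sechTheta (-(1 / 2) - N * τ) τ =
      jacobiTheta₂_term N z τ * sechTheta (-(1 / 2)) τ := by
    rw [sechTheta_sub_int_mul N hτ, jacobiTheta₂_term_add_half]
    have : ((-1 : ℂ) ^ N) * (-1) ^ N = 1 := by rw [← mul_zpow]; norm_num
    linear_combination (jacobiTheta₂_term N z τ * sechTheta (-(1 / 2)) τ) * this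
  rw [h1] at h
  refine h.congr_fun fun m ↦ ?_
  have h2 : cexp (2 * π * I * m * z) * jacobiTheta₂_term (N - m) (z + 1 / 2) τ =
      jacobiTheta₂_term N (z + 1 / 2) τ * jacobiTheta₂_term m (-(1 / 2) - N * τ) τ := by
    simp only [jacobiTheta₂_term, ← Complex.exp_add]
    push_cast
    ring_nf
  linear_combination sechCoeff τ m * h2

/-- The Fourier series with coefficients `sechCoeff` is a quotient of theta functions, up to
a constant. -/
lemma tsum_exp_mul_sechCoeff_mul (z : ℝ) {τ : ℂ} (hτ : 0 < τ.im) :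
    (∑' m : ℤ, cexp (2 * π * I * m * z) * sechCoeff τ m) * jacobiTheta₂ (z + 1 / 2) τ =
      sechTheta (-(1 / 2)) τ * jacobiTheta₂ z τ := by
  have hB := ((summable_jacobiTheta₂_term_iff (z + 1 / 2) τ).2 hτ).norm
  have hA := summable_norm_exp_mul_sechCoeff hτ z
  let e : ℤ × ℤ ≃ ℤ × ℤ :=
    { toFun := fun p ↦ (p.2, p.1 - p.2)
      invFun := fun p ↦ (p.1 + p.2, p.1)
      left_inv := fun p ↦ by simp
      right_inv := fun p ↦ by simp }
  have hs := (e.summable_iff (f := fun p : ℤ × ℤ ↦ cexp (2 * π * I * p.1 * z) * sechCoeff τ p.1 *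
      jacobiTheta₂_term p.2 (z + 1 / 2) τ)).2 (summable_mul_of_summable_norm
        (f := fun m : ℤ ↦ cexp (2 * π * I * m * z) * sechCoeff τ m)
        (g := fun n ↦ jacobiTheta₂_term n (z + 1 / 2) τ) hA hB)
  rw [jacobiTheta₂, tsum_mul_tsum_of_summable_norm hA hB, ← e.tsum_eq,
    jacobiTheta₂, ← tsum_mul_left]
  refine hs.tsum_prod.trans (tsum_congr fun N ↦ ?_)
  rw [mul_comm (sechTheta _ _)]
  exact (hasSum_exp_mul_sechCoeff_mul N z hτ).tsum_eq

/-- The terms `1 / (1 + exp (-2iπmτ))`, interpolating between `1` at `-∞` and `0` at `∞`. -/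
noncomputable def fermiCoeff (τ : ℂ) (m : ℤ) : ℂ := cexp (π * I * m * τ) * sechCoeff τ m

lemma fermiCoeff_neg {τ : ℂ} (hτ : 0 < τ.im) (m : ℤ) :
    fermiCoeff τ (-m) = 1 - fermiCoeff τ m := by
  have h := two_mul_cosh_mul_sechCoeff hτ m
  rw [Complex.two_cosh] at h
  rw [fermiCoeff, fermiCoeff, sechCoeff_neg,
    show (π * I * (-m : ℤ) * τ : ℂ) = -(π * I * m * τ) by push_cast; ring]
  linear_combination h

lemma norm_fermiCoeff_le_of_nonneg {τ : ℂ} (hτ : 0 < τ.im) {m : ℤ} (hm : 0 ≤ m) :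
    ‖fermiCoeff τ m‖ ≤ (1 - rexp (-π * τ.im))⁻¹ * rexp (-π * τ.im * m) := by
  rw [fermiCoeff, norm_mul, norm_exp_pi_mul_I_mul]
  refine (mul_le_of_le_one_left (norm_nonneg _) (Real.exp_le_one_iff.2 ?_)).trans
    (norm_sechCoeff_le_of_nonneg hτ hm)
  have h4 : 0 < π * τ.im := mul_pos Real.pi_pos hτ
  have := mul_nonneg h4.le (Int.cast_nonneg (R := ℝ) hm)
  linarith

lemma norm_fermiCoeff_le {τ : ℂ} (hτ : 0 < τ.im) (m : ℤ) :
    ‖fermiCoeff τ m‖ ≤ 1 + (1 - rexp (-π * τ.im))⁻¹ := by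
  have h0 (m : ℤ) (hm : 0 ≤ m) : ‖fermiCoeff τ m‖ ≤ (1 - rexp (-π * τ.im))⁻¹ := by
    rw [fermiCoeff, norm_mul, norm_exp_pi_mul_I_mul]
    refine (mul_le_of_le_one_left (norm_nonneg _) (Real.exp_le_one_iff.2 ?_)).trans
      (norm_sechCoeff_le_const hτ m)
    have h4 : 0 < π * τ.im := mul_pos Real.pi_pos hτ
    have := mul_nonneg h4.le (Int.cast_nonneg (R := ℝ) hm)
    linarith
  rcases le_total 0 m with hm | hm
  · linarith [h0 m hm]
  · have h := fermiCoeff_neg hτ (-m)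
    rw [neg_neg] at h
    rw [h]
    refine (norm_sub_le _ _).trans ?_
    rw [norm_one]
    linarith [h0 (-m) (by omega)]

lemma tendsto_fermiCoeff_atTop {τ : ℂ} (hτ : 0 < τ.im) :
    Tendsto (fermiCoeff τ) atTop (𝓝 0) := by
  have h4 : -π * τ.im < 0 := by
    rw [neg_mul, neg_lt_zero]
    exact mul_pos Real.pi_pos hτ
  have h : Tendsto (fun m : ℤ ↦ (1 - rexp (-π * τ.im))⁻¹ * rexp (-π * τ.im * m)) atTop
      (𝓝 ((1 - rexp (-π * τ.im))⁻¹ * 0)) :=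
    (Real.tendsto_exp_atBot.comp
      (tendsto_intCast_atTop_atTop.const_mul_atTop_of_neg h4)).const_mul _
  rw [mul_zero] at h
  refine squeeze_zero_norm' ?_ h
  filter_upwards [eventually_ge_atTop 0] with m hm
  exact norm_fermiCoeff_le_of_nonneg hτ hm

lemma tendsto_fermiCoeff_atBot {τ : ℂ} (hτ : 0 < τ.im) :
    Tendsto (fermiCoeff τ) atBot (𝓝 1) := by
  have h := ((tendsto_fermiCoeff_atTop hτ).comp tendsto_neg_atBot_atTop).const_sub 1
  rw [sub_zero] at h
  refine h.congr fun m ↦ ?_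
  rw [Function.comp, ← fermiCoeff_neg hτ, neg_neg]

/-- The difference between the sum of `d (N - n)` and the sum of `d N` over `-M ≤ N < M`. -/
noncomputable def shiftDiff (d : ℤ → ℂ) (M : ℕ) (n : ℤ) : ℂ :=
  ∑ N ∈ Finset.Ico (-M : ℤ) M, (d (N - n) - d N)

lemma sum_Ico_neg_sub (f : ℤ → ℂ) (M : ℕ) :
    ∑ N ∈ Finset.Ico (-M : ℤ) M, (f (N - 1) - f N) = f (-M - 1) - f (M - 1) := by
  induction M with
  | zero => simp
  | succ M ih =>
    have h : Finset.Ico (-(M + 1 : ℕ) : ℤ) (M + 1 : ℕ) =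
        insert (-(M : ℤ) - 1) (insert (M : ℤ) (Finset.Ico (-M : ℤ) M)) := by
      ext x
      simp only [Finset.mem_Ico, Finset.mem_insert]
      omega
    rw [h, Finset.sum_insert (by simp), Finset.sum_insert (by simp), ih]
    push_cast
    ring_nf

lemma shiftDiff_zero (d : ℤ → ℂ) (M : ℕ) : shiftDiff d M 0 = 0 := by
  simp [shiftDiff]

lemma shiftDiff_add_one (d : ℤ → ℂ) (M : ℕ) (n : ℤ) :
    shiftDiff d M (n + 1) = shiftDiff d M n + (d (-M - 1 - n) - d (M - 1 - n)) := by
  rw [← sum_Ico_neg_sub (fun N ↦ d (N - n)), shiftDiff, shiftDiff, ← Finset.sum_add_distrib]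
  refine Finset.sum_congr rfl fun N _ ↦ ?_
  ring_nf

lemma tendsto_shiftDiff {d : ℤ → ℂ} (h0 : Tendsto d atTop (𝓝 0)) (h1 : Tendsto d atBot (𝓝 1))
    (n : ℤ) : Tendsto (fun M ↦ shiftDiff d M n) atTop (𝓝 n) := by
  have hM : Tendsto (fun M : ℕ ↦ (M : ℤ)) atTop atTop := tendsto_natCast_atTop_atTop
  have hd (n : ℤ) : Tendsto (fun M : ℕ ↦ d (-M - 1 - n) - d (M - 1 - n)) atTop (𝓝 1) := by
    have ha : Tendsto (fun M : ℕ ↦ (M : ℤ) - 1 - n) atTop atTop := by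
      simpa only [sub_eq_add_neg, add_assoc] using tendsto_atTop_add_const_right _ (-1 + -n) hM
    have hb : Tendsto (fun M : ℕ ↦ -(M : ℤ) - 1 - n) atTop atBot := by
      simpa only [sub_eq_add_neg, add_assoc, Function.comp_def] using
        tendsto_atBot_add_const_right _ (-1 + -n) (tendsto_neg_atTop_atBot.comp hM)
    simpa using (h1.comp hb).sub (h0.comp ha)
  induction n using Int.induction_on with
  | zero => simp [shiftDiff_zero]
  | succ k ih =>
    simp only [shiftDiff_add_one]
    simpa using ih.add (hd k)
  | pred k ih =>
    have h (M : ℕ) := shiftDiff_add_one d M (-k - 1)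
    simp only [sub_add_cancel] at h
    have := ih.sub (hd (-k - 1))
    simp only [h, add_sub_cancel_right] at this
    simpa using this

lemma norm_shiftDiff_le {d : ℤ → ℂ} {L : ℝ} (hL : ∀ m, ‖d m‖ ≤ L) (M : ℕ) (n : ℤ) :
    ‖shiftDiff d M n‖ ≤ 2 * L * |(n : ℝ)| := by
  have hd (n : ℤ) : ‖d (-M - 1 - n) - d (M - 1 - n)‖ ≤ 2 * L :=
    (norm_sub_le _ _).trans (by linarith [hL (-M - 1 - n), hL (M - 1 - n)])
  induction n using Int.induction_on with
  | zero => simp [shiftDiff_zero]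
  | succ k ih =>
    rw [shiftDiff_add_one]
    refine (norm_add_le _ _).trans ((add_le_add ih (hd _)).trans_eq ?_)
    push_cast
    rw [abs_of_nonneg (by positivity), abs_of_nonneg (by positivity)]
    ring
  | pred k ih =>
    have h := shiftDiff_add_one d M (-k - 1)
    rw [sub_add_cancel, ← sub_eq_iff_eq_add] at h
    rw [← h]
    refine (norm_sub_le _ _).trans ((add_le_add ih (hd _)).trans_eq ?_)
    push_cast
    rw [abs_of_nonpos (by simp), abs_of_nonpos (by linarith [Nat.cast_nonneg (α := ℝ) k])]
    ring

/-- The value of `sechTheta` at `-1 / 2` in terms of the derivative of the theta function. -/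
lemma two_pi_I_mul_sechTheta_mul {τ : ℂ} (hτ : 0 < τ.im) :
    2 * π * I * (sechTheta (-(1 / 2)) τ * jacobiTheta₂ (τ / 2) τ) =
      jacobiTheta₂' (1 / 2 + τ / 2) τ := by
  set e : ℤ → ℂ := fun n ↦ jacobiTheta₂_term n (1 / 2 + τ / 2) τ with he
  have hes : HasSum e 0 := by
    have := hasSum_jacobiTheta₂_term (1 / 2 + τ / 2) hτ
    rwa [jacobiTheta₂_half_add_half] at this
  have hes' := hasSum_jacobiTheta₂'_term (1 / 2 + τ / 2) hτ
  set d := fermiCoeff τ with hd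
  have hconv (N : ℤ) : HasSum (fun n ↦ e n * d (N - n))
      (jacobiTheta₂_term N (τ / 2) τ * sechTheta (-(1 / 2)) τ) := by
    have h := hasSum_exp_mul_sechCoeff_mul N (τ / 2) hτ
    rw [← (Equiv.subLeft N).hasSum_iff] at h
    refine h.congr_fun fun n ↦ ?_
    simp only [Function.comp, Equiv.subLeft_apply, he, hd, fermiCoeff, sub_sub_cancel]
    ring_nf
  have hpart (M : ℕ) : ∑ N ∈ Finset.Ico (-M : ℤ) M,
      jacobiTheta₂_term N (τ / 2) τ * sechTheta (-(1 / 2)) τ = ∑' n, e n * shiftDiff d M n := by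
    have h1 := hasSum_sum fun N (_ : N ∈ Finset.Ico (-M : ℤ) M) ↦ hconv N
    have h2 := h1.sub (hes.mul_right (∑ N ∈ Finset.Ico (-M : ℤ) M, d N))
    rw [zero_mul, sub_zero] at h2
    rw [← h2.tsum_eq]
    refine tsum_congr fun n ↦ ?_
    simp only [shiftDiff, Finset.sum_sub_distrib, mul_sub, Finset.mul_sum]
  have hlim : Tendsto (fun M : ℕ ↦ ∑' n, e n * shiftDiff d M n) atTop (𝓝 (∑' n : ℤ, e n * n)) := by
    refine tendsto_tsum_of_dominated_convergence
      (bound := fun n ↦ ‖jacobiTheta₂'_term n (1 / 2 + τ / 2) τ‖ *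
        (2 * (1 + (1 - rexp (-π * τ.im))⁻¹) / (2 * π))) (hes'.summable.norm.mul_right _)
      (fun n ↦ (tendsto_shiftDiff (tendsto_fermiCoeff_atTop hτ)
        (tendsto_fermiCoeff_atBot hτ) n).const_mul _) (Eventually.of_forall fun M n ↦ ?_)
    rw [norm_mul]
    refine (mul_le_mul_of_nonneg_left (norm_shiftDiff_le (norm_fermiCoeff_le hτ) M n)
      (norm_nonneg _)).trans_eq ?_
    have hpi := Real.pi_ne_zero
    simp only [jacobiTheta₂'_term, norm_mul, Complex.norm_two, norm_I,
      Complex.norm_of_nonneg Real.pi_pos.le, Complex.norm_intCast, he]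
    field_simp
  have hlim' : Tendsto (fun s : Finset ℤ ↦
      ∑ N ∈ s, jacobiTheta₂_term N (τ / 2) τ * sechTheta (-(1 / 2)) τ) atTop
      (𝓝 (jacobiTheta₂ (τ / 2) τ * sechTheta (-(1 / 2)) τ)) := by
    simpa [HasSum] using (hasSum_jacobiTheta₂_term (τ / 2) hτ).mul_right (sechTheta (-(1 / 2)) τ)
  have heq := tendsto_nhds_unique
    ((hlim'.comp (Finset.tendsto_Ico_neg (R := ℤ))).congr hpart) hlim
  rw [mul_comm (sechTheta _ _), heq, jacobiTheta₂', ← tsum_mul_left]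
  refine tsum_congr fun n ↦ ?_
  rw [jacobiTheta₂'_term]
  ring

lemma jacobiTheta₁_eq (z τ : ℂ) :
    jacobiTheta₁ z τ =
      -I * (cexp (π * I * τ / 4 + π * I * z) * jacobiTheta₂ (z + (1 / 2 + τ / 2)) τ) := by
  rw [jacobiTheta₁, jacobiTheta₂, ← tsum_mul_left (a := cexp _)]
  congr 1
  refine tsum_congr fun n ↦ ?_
  rw [jacobiTheta₂_term, ← Complex.exp_pi_mul_I, ← Complex.exp_int_mul, ← Complex.exp_add,
    ← Complex.exp_add, ← Complex.exp_add]
  ring_nf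

lemma exp_pi_mul_I_div_two : cexp (π * I * (1 / 2)) = I := by
  rw [show (π * I * (1 / 2) : ℂ) = π / 2 * I by ring, Complex.exp_pi_div_two_mul_I]

lemma jTheta₂_zero (τ : ℂ) :
    jTheta₂ 0 τ = cexp (π * I * τ / 4) * jacobiTheta₂ (τ / 2) τ := by
  rw [jTheta₂, jacobiTheta₁_eq, zero_add, Complex.exp_add, exp_pi_mul_I_div_two,
    show (1 / 2 + (1 / 2 + τ / 2) : ℂ) = τ / 2 + 1 by ring, jacobiTheta₂_add_left]
  linear_combination -(cexp (π * I * τ / 4) * jacobiTheta₂ (τ / 2) τ) * I_mul_I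

lemma jTheta₄_eq (z τ : ℂ) : jTheta₄ z τ = jacobiTheta₂ (z + 1 / 2) τ := by
  have h : cexp (π * I * τ / 4) * cexp (π * I * z) * cexp (π * I * τ / 4 + π * I * (z + τ / 2)) *
      cexp (-π * I * (τ + 2 * (z + 1 / 2))) = -1 := by
    rw [← Complex.exp_add, ← Complex.exp_add, ← Complex.exp_add, ← Complex.exp_neg_pi_mul_I]
    ring_nf
  rw [jTheta₄, jacobiTheta₁_eq,
    show z + τ / 2 + (1 / 2 + τ / 2) = z + 1 / 2 + τ by ring, jacobiTheta₂_add_left']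
  linear_combination I * I * jacobiTheta₂ (z + 1 / 2) τ * h -
    jacobiTheta₂ (z + 1 / 2) τ * I_mul_I

lemma jTheta₃_eq (z τ : ℂ) : jTheta₃ z τ = jacobiTheta₂ z τ := by
  rw [jTheta₃, jTheta₄_eq, ← jacobiTheta₂_add_left z]
  ring_nf

lemma jacobiTheta₁'_zero_s16 {τ : ℂ} (hτ : 0 < τ.im) :
    jacobiTheta₁' 0 τ = -I * (cexp (π * I * τ / 4) * jacobiTheta₂' (1 / 2 + τ / 2) τ) := by
  have h1 : HasDerivAt (fun w ↦ jacobiTheta₂ (w + (1 / 2 + τ / 2)) τ)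
      (jacobiTheta₂' (0 + (1 / 2 + τ / 2)) τ) 0 :=
    (hasDerivAt_jacobiTheta₂_fst (0 + (1 / 2 + τ / 2)) hτ).comp_add_const 0 _
  have h2 : HasDerivAt (fun w : ℂ ↦ cexp (π * I * τ / 4 + π * I * w))
      (cexp (π * I * τ / 4 + π * I * 0) * (π * I * 1)) 0 :=
    (((hasDerivAt_id (0 : ℂ)).const_mul (π * I)).const_add (π * I * τ / 4)).cexp
  have h3 := ((h2.mul h1).const_mul (-I)).deriv
  rw [jacobiTheta₁', funext (fun w ↦ jacobiTheta₁_eq w τ)]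
  refine h3.trans ?_
  rw [zero_add, jacobiTheta₂_half_add_half]
  simp

/-- Closed form for the density `ρ(z) = ∑_{m∈ℤ} e^{2πimz}/(2 cosh(iπm η̃))`. -/
theorem density_closed_form (ηt : ℂ) (hη : 0 < ηt.im) (z : ℝ) :
    (∑' m : ℤ, Complex.exp (2 * (π : ℂ) * Complex.I * (m : ℂ) * (z : ℂ)) /
        (2 * Complex.cosh ((π : ℂ) * Complex.I * (m : ℂ) * ηt)))
      = 1 / (2 * (π : ℂ)) *
          (jacobiTheta₁' 0 ηt * jTheta₃ (z : ℂ) ηt /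
            (jTheta₂ 0 ηt * jTheta₄ (z : ℂ) ηt)) := by
  have hsum : (∑' m : ℤ, cexp (2 * π * I * m * z) / (2 * Complex.cosh (π * I * m * ηt))) =
      ∑' m : ℤ, cexp (2 * π * I * m * z) * sechCoeff ηt m :=
    tsum_congr fun m ↦ div_eq_mul_one_div _ _
  have h4 : jacobiTheta₂ (z + 1 / 2) ηt ≠ 0 := by
    have := jacobiTheta₂_ofReal_ne_zero (z + 1 / 2) hη
    push_cast at this
    exact this
  have h2 := jacobiTheta₂_half_period_ne_zero hη
  have hpi : (π : ℂ) ≠ 0 := by exact_mod_cast Real.pi_ne_zero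
  rw [hsum, eq_div_of_mul_eq h4 (tsum_exp_mul_sechCoeff_mul z hη), jTheta₂_zero, jTheta₃_eq,
    jTheta₄_eq, jacobiTheta₁'_zero_s16 hη, ← two_pi_I_mul_sechTheta_mul hη]
  have hexp := Complex.exp_ne_zero (π * I * ηt / 4)
  generalize jacobiTheta₂ (z + 1 / 2) ηt = w at h4 ⊢
  field_simp
  linear_combination sechTheta (-(1 / 2)) ηt * jacobiTheta₂ z ηt * I_sq
end
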